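/- arXiv:1509.05822 — 3 statements merged into one kernel-verified Lean document; each statement's English description precedes it below -/
import Mathlib

section
/- Let d ≥ 3 be an integer, let a > -((d-2)/2)² be real, and let δ₀ ∈ (0,1). Let W := W_{min(a,0)} be the ground state soliton with coupling min(a,0), K := Q_{min(a,0)}(W), and E_W := E_{min(a,0)}(W) = K/d. Then there exist constants δ₁ > 0 and c > 0, depending only on d, a, δ₀, such that for every f ∈ C_c^∞(ℝ^d \ {0}; ℂ) satisfying E_a(f) ≤ (1-δ₀) E_W and Q_a(f) ≥ K, one has: (1) Q_a(f) ≥ (1+δ₁) K; and (2) ∫_{ℝ^d} (|∇f|² + (a/|x|²)|f|² - |f|^{2d/(d-2)}) dx ≤ -c < 0. -/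
open MeasureTheory

/-- The closed cube `[-L, L]^n`. -/
def cube (n : ℕ) (L : ℝ) : Set (Fin n → ℝ) := Set.univ.pi fun _ => Set.Icc (-L) L

theorem isCompact_cube (n : ℕ) (L : ℝ) : IsCompact (cube n L) :=
  isCompact_univ_pi fun _ => isCompact_Icc

theorem measurableSet_cube (n : ℕ) (L : ℝ) : MeasurableSet (cube n L) :=
  (isCompact_cube n L).isClosed.measurableSet

theorem insertNth_mem_cube {n : ℕ} {L : ℝ} (k : Fin (n + 1)) (t : ℝ) (x : Fin n → ℝ) :
    k.insertNth (α := fun _ => ℝ) t x ∈ cube (n + 1) L ↔ t ∈ Set.Icc (-L) L ∧ x ∈ cube n L := by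
  simp only [cube, Set.mem_univ_pi]
  constructor
  · intro h
    refine ⟨by simpa using h k, fun i => by simpa using h (k.succAbove i)⟩
  · rintro ⟨h1, h2⟩ i
    refine Fin.succAboveCases k ?_ ?_ i
    · simpa using h1
    · intro j; simpa using h2 j

theorem setIntegral_cube_succ {n : ℕ} {L : ℝ} (hL : 0 < L) (k : Fin (n + 1))
    {H : (Fin (n + 1) → ℝ) → ℝ} (hH : IntegrableOn H (cube (n + 1) L)) :
    ∫ x in cube (n + 1) L, H x =
      ∫ x in cube n L, ∫ t in (-L)..L, H (k.insertNth (α := fun _ => ℝ) t x) := by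
  have mp := (volume_preserving_piFinSuccAbove (fun _ : Fin (n + 1) => ℝ) k).symm
  have hpre : (MeasurableEquiv.piFinSuccAbove (fun _ : Fin (n + 1) => ℝ) k).symm ⁻¹'
      cube (n + 1) L = Set.Icc (-L) L ×ˢ cube n L := by
    ext ⟨t, x⟩
    exact insertNth_mem_cube k t x
  have h1 := mp.setIntegral_preimage_emb (MeasurableEquiv.measurableEmbedding _) H (cube (n + 1) L)
  have h2 := (mp.integrableOn_comp_preimage (MeasurableEquiv.measurableEmbedding _)).2 hH
  rw [hpre] at h1 h2
  rw [← h1, Measure.volume_eq_prod, ← Measure.prod_restrict]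
  rw [Measure.volume_eq_prod, IntegrableOn, ← Measure.prod_restrict] at h2
  refine (integral_prod_symm _ h2).trans ?_
  refine integral_congr_ae (Filter.Eventually.of_forall fun x => ?_)
  beta_reduce
  rw [intervalIntegral.integral_of_le (by linarith), integral_Icc_eq_integral_Ioc]
  rfl


/-- The primitive of a continuous function bounded below by a positive constant is an order
isomorphism of `ℝ`. -/
theorem exists_orderIso_primitive {q : ℝ → ℝ} (hq : Continuous q) {c : ℝ} (hc : 0 < c)
    (hcq : ∀ s, c ≤ q s) (a : ℝ) : ∃ e : ℝ ≃o ℝ, ∀ s, e s = ∫ t in a..s, q t := by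
  have hd : ∀ s, HasDerivAt (fun s => ∫ t in a..s, q t) (q s) s := fun s =>
    intervalIntegral.integral_hasDerivAt_right (hq.intervalIntegrable _ _)
      hq.stronglyMeasurable.stronglyMeasurableAtFilter hq.continuousAt
  have hmono : StrictMono fun s => ∫ t in a..s, q t :=
    strictMono_of_deriv_pos fun s => by rw [(hd s).deriv]; exact hc.trans_le (hcq s)
  have hcont : Continuous fun s => ∫ t in a..s, q t :=
    continuous_iff_continuousAt.2 fun s => (hd s).continuousAt
  have hlin : ∀ s, a ≤ s → c * (s - a) ≤ ∫ t in a..s, q t := fun s hs => by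
    have := intervalIntegral.integral_mono_on (μ := volume) hs (f := fun _ => c) (g := q)
      (by simp) (hq.intervalIntegrable _ _) (fun t _ => hcq t)
    simpa [mul_comm] using this
  have hlin' : ∀ s, s ≤ a → ∫ t in a..s, q t ≤ c * (s - a) := fun s hs => by
    have := intervalIntegral.integral_mono_on (μ := volume) hs (f := fun _ => c) (g := q)
      (by simp) (hq.intervalIntegrable _ _) (fun t _ => hcq t)
    rw [intervalIntegral.integral_symm]
    simp only [intervalIntegral.integral_const, smul_eq_mul] at this
    linarith
  have hsurj : Function.Surjective fun s => ∫ t in a..s, q t := by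
    refine hcont.surjective ?_ ?_
    · refine Filter.tendsto_atTop_mono' _ (f₁ := fun s => c * (s - a)) ?_ ?_
      · filter_upwards [Filter.eventually_ge_atTop a] with s hs using hlin s hs
      · exact (Filter.tendsto_atTop_add_const_right _ (-a) Filter.tendsto_id).const_mul_atTop hc
    · refine Filter.tendsto_atBot_mono' _ (f₁ := fun s => c * (s - a)) ?_ ?_
      · filter_upwards [Filter.eventually_le_atBot a] with s hs using hlin' s hs
      · exact (Filter.tendsto_atBot_add_const_right _ (-a) Filter.tendsto_id).const_mul_atBot hc
  exact ⟨StrictMono.orderIsoOfSurjective _ hmono hsurj, fun s => rfl⟩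

/-- Monotone rearrangement in one variable. -/
theorem hasDerivAt_monotone_transport {p q : ℝ → ℝ} (hp : Continuous p) (hq : Continuous q) {c : ℝ}
    (hc : 0 < c) (hcq : ∀ s, c ≤ q s) {a : ℝ} (l : ℝ) (e : ℝ ≃o ℝ)
    (he : ∀ s, e s = ∫ t in a..s, q t) (t : ℝ) :
    HasDerivAt (fun t => e.symm (l * ∫ r in a..t, p r))
      (l * p t / q (e.symm (l * ∫ r in a..t, p r))) t := by
  have hd : ∀ {q : ℝ → ℝ}, Continuous q → ∀ s, HasDerivAt (fun s => ∫ t in a..s, q t) (q s) s :=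
    fun hq s => intervalIntegral.integral_hasDerivAt_right (hq.intervalIntegrable _ _)
      hq.stronglyMeasurable.stronglyMeasurableAtFilter hq.continuousAt
  have hde : ∀ s, HasDerivAt e (q s) s := fun s => by
    rw [funext he]; exact hd hq s
  have hsymm : ∀ u, HasDerivAt e.symm (q (e.symm u))⁻¹ u := fun u =>
    HasDerivAt.of_local_left_inverse e.symm.continuous.continuousAt (hde _)
      (hc.trans_le (hcq _)).ne' (Filter.Eventually.of_forall fun u => e.apply_symm_apply u)
  have := (hsymm (l * ∫ r in a..t, p r)).comp t ((hd hp t).const_mul l)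
  rw [div_eq_inv_mul]
  exact this

theorem continuous_intervalIntegral_cons {n : ℕ} {L : ℝ} {F : (Fin (n + 1) → ℝ) → ℝ}
    (hF : Continuous F) {X : Type*} [TopologicalSpace X] {u : X → ℝ} {v : X → Fin n → ℝ}
    (hu : Continuous u) (hv : Continuous v) :
    Continuous fun x => ∫ t in (-L)..(u x), F (Fin.cons t (v x)) := by
  have h : Continuous fun z : (ℝ × (Fin n → ℝ)) => ∫ t in (-L)..z.1, F (Fin.cons t z.2) := by
    refine intervalIntegral.continuous_parametric_intervalIntegral_of_continuous ?_ continuous_fst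
    refine hF.comp ?_
    exact (continuous_snd : Continuous fun z : (ℝ × (Fin n → ℝ)) × ℝ => z.2).finCons
      (continuous_snd.comp continuous_fst)
  exact h.comp (hu.prodMk hv)

theorem volume_cube_lt_top (n : ℕ) (L : ℝ) : volume (cube n L) < ⊤ :=
  (isCompact_cube n L).measure_lt_top

theorem integrableOn_cube_of_bound {n : ℕ} {L : ℝ} {H : (Fin n → ℝ) → ℝ} (hH : Measurable H)
    {M : ℝ} (hM : ∀ x ∈ cube n L, |H x| ≤ M) : IntegrableOn H (cube n L) :=
  Measure.integrableOn_of_bounded (M := M) (volume_cube_lt_top n L).ne hH.aestronglyMeasurable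
    ((ae_restrict_iff' (measurableSet_cube n L)).2 (Filter.Eventually.of_forall hM))

/-- A measurable triangular map transporting `F` to `G` on the cube, with diagonal
partial derivatives `D` (the Knothe rearrangement). -/
theorem exists_knothe_map {L : ℝ} (hL : 0 < L) (n : ℕ) :
    ∀ F G : (Fin n → ℝ) → ℝ, Continuous F → Continuous G →
    (∃ c C : ℝ, 0 < c ∧ ∀ x, c ≤ F x ∧ F x ≤ C) → (∃ c C : ℝ, 0 < c ∧ ∀ x, c ≤ G x ∧ G x ≤ C) →
    ∫ x in cube n L, F x = ∫ x in cube n L, G x →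
    ∃ T D : (Fin n → ℝ) → Fin n → ℝ, Measurable T ∧ Measurable D ∧
      (∀ x ∈ cube n L, T x ∈ cube n L) ∧
      (∃ M : ℝ, ∀ x k, 0 ≤ D x k ∧ D x k ≤ M) ∧
      (∀ x, (∏ k, D x k) * G (T x) = F x) ∧
      (∀ x k t, HasDerivAt (fun s => T (Function.update x k s) k)
        (D (Function.update x k t) k) t) ∧
      ∀ φ : (Fin n → ℝ) → ℝ, Continuous φ →
        ∫ x in cube n L, φ (T x) * F x = ∫ y in cube n L, φ y * G y := by
  induction n with
  | zero =>
    intro F G _ _ _ _ hm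
    have huniv : cube 0 L = Set.univ := by ext x; simp [cube]
    have hFG : F = G := by
      rw [huniv, Measure.restrict_univ] at hm
      have e : ∀ F : (Fin 0 → ℝ) → ℝ, ∫ x, F x = F default := fun F => by
        rw [show F = fun _ => F default from funext fun x => congrArg F (Subsingleton.elim _ _)]
        simp [Measure.real, volume_pi]
      rw [e, e] at hm
      exact funext fun x => by rwa [Subsingleton.elim x default]
    subst hFG
    exact ⟨id, fun _ => 0, measurable_id, measurable_const, fun x hx => hx,
      ⟨0, fun x k => k.elim0⟩, fun x => by simp, fun x k => k.elim0, fun φ _ => rfl⟩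
  | succ n ih =>
    rintro F G hF hG ⟨cF, CF, hcF, hFb⟩ ⟨cG, CG, hcG, hGb⟩ hm
    have hcons : ∀ (x : Fin n → ℝ), Continuous fun t : ℝ => (Fin.cons t x : Fin (n + 1) → ℝ) :=
      fun x => Continuous.finCons (A := fun _ => ℝ) continuous_id continuous_const
    have hcube : ∀ t (x : Fin n → ℝ), (Fin.cons t x : Fin (n + 1) → ℝ) ∈ cube (n + 1) L ↔
        t ∈ Set.Icc (-L) L ∧ x ∈ cube n L := fun t x => by
      rw [← insertNth_mem_cube 0, Fin.insertNth_zero']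
    have hbox : ∀ {H : (Fin (n + 1) → ℝ) → ℝ}, IntegrableOn H (cube (n + 1) L) →
        ∫ x in cube (n + 1) L, H x = ∫ x in cube n L, ∫ t in (-L)..L, H (Fin.cons t x) :=
      fun hH => by
        simpa only [Fin.insertNth_zero'] using setIntegral_cube_succ hL 0 hH
    have hintg : ∀ {H : (Fin (n + 1) → ℝ) → ℝ}, Continuous H → IntegrableOn H (cube (n + 1) L) :=
      fun hH => hH.continuousOn.integrableOn_compact (isCompact_cube _ _)
    have hmarg : ∀ {H : (Fin (n + 1) → ℝ) → ℝ}, Continuous H → ∀ {c C : ℝ},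
        (∀ x, c ≤ H x ∧ H x ≤ C) → ∀ x : Fin n → ℝ,
        2 * L * c ≤ ∫ t in (-L)..L, H (Fin.cons t x) ∧
        ∫ t in (-L)..L, H (Fin.cons t x) ≤ 2 * L * C := fun {H} hH {c C} hb x => by
      have hi := ((hH.comp (hcons x)).intervalIntegrable (μ := volume) (-L) L)
      have h1 := intervalIntegral.integral_mono_on (μ := volume) (by linarith : -L ≤ L)
        (f := fun _ => c) (by simp) hi (fun t _ => (hb _).1)
      have h2 := intervalIntegral.integral_mono_on (μ := volume) (by linarith : -L ≤ L)
        (g := fun _ => C) hi (by simp) (fun t _ => (hb _).2)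
      simp only [intervalIntegral.integral_const, smul_eq_mul, Function.comp_apply] at h1 h2
      constructor <;> linarith
    set F' : (Fin n → ℝ) → ℝ := fun x => ∫ t in (-L)..L, F (Fin.cons t x) with hF'
    set G' : (Fin n → ℝ) → ℝ := fun x => ∫ t in (-L)..L, G (Fin.cons t x) with hG'
    have hF'b := hmarg hF hFb
    have hG'b := hmarg hG hGb
    have hF'c : Continuous F' := continuous_intervalIntegral_cons hF continuous_const continuous_id
    have hG'c : Continuous G' := continuous_intervalIntegral_cons hG continuous_const continuous_id
    have hF'0 : ∀ x, 0 < F' x := fun x => lt_of_lt_of_le (by positivity) (hF'b x).1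
    have hG'0 : ∀ x, 0 < G' x := fun x => lt_of_lt_of_le (by positivity) (hG'b x).1
    obtain ⟨T', D', hT'm, hD'm, hT'c, ⟨M, hM⟩, hprod, hder, hpush⟩ :=
      ih F' G' hF'c hG'c ⟨_, _, by positivity, hF'b⟩ ⟨_, _, by positivity, hG'b⟩ (by
        rw [← hbox (hintg hF), ← hbox (hintg hG)]; exact hm)
    choose e he using fun y : Fin n → ℝ => exists_orderIso_primitive (q := fun t => G (Fin.cons t y))
      (hG.comp (hcons y)) hcG (fun s => (hGb _).1) (-L)
    set l : (Fin n → ℝ) → ℝ := fun x => G' (T' x) / F' x with hl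
    have hl0 : ∀ x, 0 < l x := fun x => div_pos (hG'0 _) (hF'0 _)
    set τ : ℝ → (Fin n → ℝ) → ℝ :=
      fun t x => (e (T' x)).symm (l x * ∫ r in (-L)..t, F (Fin.cons r x)) with hτ
    set T : (Fin (n + 1) → ℝ) → Fin (n + 1) → ℝ :=
      fun x => Fin.cons (τ (x 0) (Fin.tail x)) (T' (Fin.tail x)) with hT
    set D : (Fin (n + 1) → ℝ) → Fin (n + 1) → ℝ :=
      fun x => Fin.cons (l (Fin.tail x) * F x / G (T x)) (D' (Fin.tail x)) with hD
    have hTcons : ∀ t x, T (Fin.cons t x) = Fin.cons (τ t x) (T' x) := fun t x => by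
      simp [hT]
    have htail : Measurable (Fin.tail : (Fin (n + 1) → ℝ) → Fin n → ℝ) :=
      measurable_pi_lambda _ fun i => measurable_pi_apply _
    have htailc : Continuous (Fin.tail : (Fin (n + 1) → ℝ) → Fin n → ℝ) :=
      continuous_pi fun i => continuous_apply _
    have hlm : Measurable l := (hG'c.measurable.comp hT'm).div hF'c.measurable
    have hτm : Measurable fun x : Fin (n + 1) → ℝ => τ (x 0) (Fin.tail x) := by
      refine measurable_of_Iio fun s => ?_
      have : (fun x : Fin (n + 1) → ℝ => τ (x 0) (Fin.tail x)) ⁻¹' Set.Iio s =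
          {x | l (Fin.tail x) * (∫ r in (-L)..(x 0), F (Fin.cons r (Fin.tail x))) <
            ∫ r in (-L)..s, G (Fin.cons r (T' (Fin.tail x)))} := by
        ext x
        simp only [Set.mem_preimage, Set.mem_Iio, Set.mem_ofPred_eq, hτ, ← he]
        exact OrderIso.symm_apply_lt _
      rw [this]
      refine measurableSet_lt ?_ ?_
      · exact (hlm.comp htail).mul
          (continuous_intervalIntegral_cons hF (continuous_apply 0) htailc).measurable
      · exact (continuous_intervalIntegral_cons (L := L) hG (continuous_const (y := s))
          continuous_id).measurable.comp (hT'm.comp htail)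
    have hTm : Measurable T := by
      refine measurable_pi_lambda _ fun i => ?_
      refine Fin.cases ?_ (fun j => ?_) i
      · simpa [hT] using hτm
      · exact (measurable_pi_apply j).comp (hT'm.comp htail)
    have hDm : Measurable D := by
      refine measurable_pi_lambda _ fun i => ?_
      refine Fin.cases ?_ (fun j => ?_) i
      · exact ((hlm.comp htail).mul hF.measurable).div (hG.measurable.comp hTm)
      · exact (measurable_pi_apply j).comp (hD'm.comp htail)
    have hτd : ∀ x t, HasDerivAt (fun t => τ t x)
        (l x * F (Fin.cons t x) / G (Fin.cons (τ t x) (T' x))) t := fun x t =>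
      hasDerivAt_monotone_transport (hF.comp (hcons x)) (hG.comp (hcons _)) hcG
        (fun s => (hGb _).1) (l x) (e (T' x)) (he (T' x)) t
    have hτL : ∀ x, τ L x = L := fun x => by
      have h1 : l x * F' x = e (T' x) L := by
        rw [he, hl]; field_simp [(hF'0 x).ne']; rfl
      exact (OrderIso.symm_apply_eq _).2 h1
    have hτL' : ∀ x, τ (-L) x = -L := fun x => by
      simp only [hτ]
      rw [OrderIso.symm_apply_eq, he]; simp
    have hτmono : ∀ x, Monotone fun t => τ t x := fun x =>
      monotone_of_deriv_nonneg (fun t => (hτd x t).differentiableAt) fun t => by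
        rw [(hτd x t).deriv]
        exact div_nonneg (mul_nonneg (hl0 x).le (hcF.le.trans (hFb _).1)) (hcG.le.trans (hGb _).1)
    have hTcube : ∀ x ∈ cube (n + 1) L, T x ∈ cube (n + 1) L := fun x hx => by
      rw [← Fin.cons_self_tail x, hcube] at hx
      refine (hcube _ _).2 ⟨⟨?_, ?_⟩, hT'c _ hx.2⟩
      · simpa only [hτL'] using hτmono (Fin.tail x) hx.1.1
      · simpa only [hτL] using hτmono (Fin.tail x) hx.1.2
    refine ⟨T, D, hTm, hDm, hTcube,
      ⟨max M (2 * L * CG / (2 * L * cF) * CF / cG), fun x k => ?_⟩, fun x => ?_, ?_, ?_⟩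
    · refine Fin.cases ?_ (fun j => ?_) k
      · simp only [hD, Fin.cons_zero]
        have hF0 : 0 < F x := hcF.trans_le (hFb x).1
        have hG0 : 0 < G (T x) := hcG.trans_le (hGb _).1
        refine ⟨div_nonneg (mul_nonneg (hl0 _).le hF0.le) hG0.le, le_max_of_le_right ?_⟩
        have h1 := (hFb x).2
        have h2 := (hGb (T x)).1
        have h3 := (hG'b (T' (Fin.tail x))).2
        have h4 := (hF'b (Fin.tail x)).1
        have h5 := (hG'0 (T' (Fin.tail x))).le
        have h6 : 0 ≤ CF := hF0.le.trans h1
        have h7 : 0 ≤ 2 * L * CG := h5.trans h3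
        simp only [hl]
        gcongr
      · simp only [hD, Fin.cons_succ]
        exact ⟨(hM _ _).1, (hM _ _).2.trans (le_max_left _ _)⟩
    · rw [Fin.prod_univ_succ]
      simp only [hD, Fin.cons_zero, Fin.cons_succ]
      have hG0 : 0 < G (T x) := hcG.trans_le (hGb _).1
      have h1 := hprod (Fin.tail x)
      have h2 := hF'0 (Fin.tail x)
      rw [div_mul_eq_mul_div, div_mul_cancel₀ _ hG0.ne']
      simp only [hl]
      rw [div_mul_eq_mul_div, div_mul_eq_mul_div, div_eq_iff h2.ne', ← h1]
      ring
    · intro x k t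
      refine Fin.cases ?_ (fun j => ?_) k
      · have hu : ∀ s, Function.update x 0 s = Fin.cons s (Fin.tail x) := fun s => by
          rw [← Fin.cons_self_tail x, Fin.update_cons_zero, Fin.tail_cons]
        simp only [hu, hTcons, hD, Fin.cons_zero, Fin.tail_cons]
        exact hτd _ _
      · simpa [hT, hD] using hder (Fin.tail x) j t
    · intro φ hφ
      have hφb : ∃ B, ∀ x ∈ cube (n + 1) L, |φ x| ≤ B :=
        (isCompact_cube (n + 1) L).exists_bound_of_continuousOn hφ.continuousOn
      obtain ⟨B, hB⟩ := hφb
      have hi : IntegrableOn (fun x => φ (T x) * F x) (cube (n + 1) L) := by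
        refine integrableOn_cube_of_bound ((hφ.measurable.comp hTm).mul hF.measurable)
          (M := B * CF) fun x hx => ?_
        rw [abs_mul]
        have h1 := hB _ (hTcube x hx)
        have h2 : |F x| ≤ CF := by rw [abs_of_pos (hcF.trans_le (hFb x).1)]; exact (hFb x).2
        exact mul_le_mul h1 h2 (abs_nonneg _) ((abs_nonneg _).trans h1)
      rw [hbox hi, hbox (H := fun x => φ x * G x) (hintg (hφ.mul hG))]
      set ψ : (Fin n → ℝ) → ℝ := fun y => (∫ s in (-L)..L, φ (Fin.cons s y) * G (Fin.cons s y)) / G' y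
        with hψ
      have hψc : Continuous ψ := (continuous_intervalIntegral_cons (hφ.mul hG) continuous_const
        continuous_id).div hG'c fun y => (hG'0 y).ne'
      have key : ∀ x, ∫ t in (-L)..L, φ (T (Fin.cons t x)) * F (Fin.cons t x) = ψ (T' x) * F' x := by
        intro x
        have hτc : Continuous fun t => τ t x :=
          continuous_iff_continuousAt.2 fun t => (hτd x t).continuousAt
        have hs := intervalIntegral.integral_comp_mul_deriv (a := -L) (b := L)
          (f := fun t => τ t x) (f' := fun t => l x * F (Fin.cons t x) / G (Fin.cons (τ t x) (T' x)))
          (g := fun s => φ (Fin.cons s (T' x)) * G (Fin.cons s (T' x)))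
          (fun t _ => hτd x t)
          ((((hF.comp (hcons x)).const_mul _).div (hG.comp ((hcons _).comp hτc))
            fun t => (hcG.trans_le (hGb _).1).ne').continuousOn)
          ((hφ.comp (hcons _)).mul (hG.comp (hcons _)))
        simp only [hτL, hτL', Function.comp_apply] at hs
        simp only [hψ]
        rw [← hs, div_mul_eq_mul_div, eq_div_iff (hG'0 _).ne', mul_comm _ (G' _), mul_comm _ (F' _),
          ← intervalIntegral.integral_const_mul, ← intervalIntegral.integral_const_mul]
        refine intervalIntegral.integral_congr fun t _ => ?_
        have hG0 : G (Fin.cons (τ t x) (T' x)) ≠ 0 := (hcG.trans_le (hGb _).1).ne'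
        have hF0 := (hF'0 x).ne'
        simp only [hTcons, hl]
        field_simp
      rw [setIntegral_congr_fun (measurableSet_cube n L) fun x _ => key x, hpush ψ hψc]
      refine setIntegral_congr_fun (measurableSet_cube n L) fun y _ => ?_
      simp only [hψ]
      rw [div_mul_cancel₀ _ (ne_of_gt (hG'0 y))]

/-- Integration by parts against a component of a map preserving the cube. -/
theorem abs_setIntegral_cube_add_mul_deriv_le {m : ℕ} {L ε : ℝ} (hL : 0 < L) (hε : 0 < ε)
    (k : Fin (m + 1))
    {h h' : (Fin (m + 1) → ℝ) → ℝ} (hc : Continuous h) (hc' : Continuous h')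
    (hd : ∀ x t, HasDerivAt (fun s => h (Function.update x k s)) (h' (Function.update x k t)) t)
    (hbd : ∀ x, |x k| = L → h x = 0)
    {τ δ : (Fin (m + 1) → ℝ) → ℝ} (hτ : Measurable τ) (hδ : Measurable δ)
    (hτL : ∀ x ∈ cube (m + 1) L, |τ x| ≤ L) {M : ℝ} (hM : ∀ x, |δ x| ≤ M)
    (hτd : ∀ x t, HasDerivAt (fun s => τ (Function.update x k s)) (δ (Function.update x k t)) t) :
    |∫ x in cube (m + 1) L, ((h x + ε) * δ x + h' x * τ x)| ≤
      2 * ε * L * volume.real (cube m L) := by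
  obtain ⟨B, hB⟩ := (isCompact_cube (m + 1) L).exists_bound_of_continuousOn
    (f := fun x => h x + ε) (by fun_prop)
  obtain ⟨B', hB'⟩ := (isCompact_cube (m + 1) L).exists_bound_of_continuousOn hc'.continuousOn
  have hi : IntegrableOn (fun x => (h x + ε) * δ x + h' x * τ x) (cube (m + 1) L) := by
    refine Integrable.add ?_ ?_
    · refine integrableOn_cube_of_bound (M := B * M) (by fun_prop) fun x hx => ?_
      rw [abs_mul]
      exact mul_le_mul (hB x hx) (hM x) (abs_nonneg _) ((norm_nonneg _).trans (hB x hx))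
    · refine integrableOn_cube_of_bound (M := B' * L) (by fun_prop) fun x hx => ?_
      rw [abs_mul]
      exact mul_le_mul (hB' x hx) (hτL x hx) (abs_nonneg _) ((norm_nonneg _).trans (hB' x hx))
  rw [setIntegral_cube_succ hL k hi, ← Real.norm_eq_abs]
  refine norm_setIntegral_le_of_norm_le_const (C := 2 * ε * L) (volume_cube_lt_top m L)
    fun x hx => ?_
  have hu : ∀ s : ℝ, Function.update (k.insertNth (α := fun _ => ℝ) 0 x) k s =
      k.insertNth (α := fun _ => ℝ) s x := fun s => by simp
  have hins : Continuous fun s : ℝ => k.insertNth (α := fun _ => ℝ) s x := by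
    simpa only [hu, id] using
      (continuous_const (y := k.insertNth (α := fun _ => ℝ) 0 x)).update k (continuous_id (X := ℝ))
  have h1 : ∀ t, HasDerivAt (fun s => h (k.insertNth (α := fun _ => ℝ) s x) + ε)
      (h' (k.insertNth (α := fun _ => ℝ) t x)) t := fun t => by
    simpa only [hu] using (hd (k.insertNth (α := fun _ => ℝ) 0 x) t).add_const ε
  have h2 : ∀ t, HasDerivAt (fun s => τ (k.insertNth (α := fun _ => ℝ) s x))
      (δ (k.insertNth (α := fun _ => ℝ) t x)) t := fun t => by
    simpa only [hu] using hτd (k.insertNth (α := fun _ => ℝ) 0 x) t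
  have key := intervalIntegral.integral_deriv_mul_eq_sub (a := -L) (b := L)
    (fun t _ => h1 t) (fun t _ => h2 t) ((hc'.comp hins).intervalIntegrable _ _) (by
      refine (intervalIntegrable_const (c := M)).mono_fun
        (hδ.comp hins.measurable).aestronglyMeasurable
        (Filter.Eventually.of_forall fun t => ?_)
      simp only [Real.norm_eq_abs]
      exact (hM _).trans (le_abs_self _))
  have hb : ∀ s, |s| = L → h (k.insertNth (α := fun _ => ℝ) s x) = 0 := fun s hs =>
    hbd _ (by simpa using hs)
  rw [hb L (abs_of_pos hL), hb (-L) (by simp [abs_of_pos hL])] at key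
  have e : ∫ t in (-L)..L, ((h (k.insertNth (α := fun _ => ℝ) t x) + ε) *
        δ (k.insertNth (α := fun _ => ℝ) t x) +
        h' (k.insertNth (α := fun _ => ℝ) t x) * τ (k.insertNth (α := fun _ => ℝ) t x)) =
      (0 + ε) * τ (k.insertNth (α := fun _ => ℝ) L x) -
        (0 + ε) * τ (k.insertNth (α := fun _ => ℝ) (-L) x) := by
    rw [← key]
    exact intervalIntegral.integral_congr fun t _ => by ring
  rw [e, Real.norm_eq_abs]
  have m1 := abs_le.1 (hτL _ ((insertNth_mem_cube k L x).2 ⟨⟨by linarith, le_rfl⟩, hx⟩))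
  have m2 := abs_le.1 (hτL _ ((insertNth_mem_cube k (-L) x).2 ⟨⟨le_rfl, by linarith⟩, hx⟩))
  rw [abs_le]
  constructor <;> nlinarith

theorem mul_rpow_le_sum_of_prod_mul_eq {n : ℕ} (hn : 0 < n) {D : Fin n → ℝ} (hD : ∀ k, 0 ≤ D k)
    {f g : ℝ} (hf : 0 < f) (hg : 0 < g) (h : (∏ k, D k) * g = f) :
    n * (g ^ (-(1 / n : ℝ)) * f) ≤ f ^ (1 - 1 / n : ℝ) * ∑ k, D k := by
  have hn' : (0 : ℝ) < n := by exact_mod_cast hn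
  have amgm := Real.geom_mean_le_arith_mean_weighted Finset.univ (fun _ : Fin n => (1 / n : ℝ)) D
    (fun _ _ => by positivity) (by simp [hn'.ne']) (fun k _ => hD k)
  rw [Real.finsetProd_rpow _ _ (fun k _ => hD k), ← Finset.mul_sum,
    eq_div_of_mul_eq hg.ne' h, Real.div_rpow hf.le hg.le] at amgm
  rw [Real.rpow_sub hf, Real.rpow_one, Real.rpow_neg hg.le]
  have h1 : 0 < f ^ (1 / n : ℝ) := Real.rpow_pos_of_pos hf _
  have h2 : 0 < g ^ (1 / n : ℝ) := Real.rpow_pos_of_pos hg _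
  generalize f ^ (1 / n : ℝ) = u at *
  generalize g ^ (1 / n : ℝ) = v at *
  rw [div_mul_eq_mul_div, le_div_iff₀ h1]
  rw [one_div, inv_mul_eq_div, div_le_div_iff₀ h2 hn'] at amgm
  have : n * (v⁻¹ * f) * u = f * (u * n) / v := by ring
  rw [this, div_le_iff₀ h2]
  nlinarith

/-- Transport inequality on a cube. -/
theorem transport_inequality_cube {m : ℕ} {L ε : ℝ} (hL : 0 < L) (hε : 0 < ε)
    {h : (Fin (m + 1) → ℝ) → ℝ} {h' : Fin (m + 1) → (Fin (m + 1) → ℝ) → ℝ}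
    {w : Fin (m + 1) → (Fin (m + 1) → ℝ) → ℝ}
    {F G : (Fin (m + 1) → ℝ) → ℝ}
    (hc : Continuous h) (hc' : ∀ k, Continuous (h' k)) (hwc : ∀ k, Continuous (w k))
    (hd : ∀ k x t, HasDerivAt (fun s => h (Function.update x k s))
      (h' k (Function.update x k t)) t)
    (hbd : ∀ k x, |x k| = L → h x = 0)
    (hF : Continuous F) (hG : Continuous G)
    (hFb : ∃ c C : ℝ, 0 < c ∧ ∀ x, c ≤ F x ∧ F x ≤ C)
    (hGb : ∃ c C : ℝ, 0 < c ∧ ∀ x, c ≤ G x ∧ G x ≤ C)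
    (hFh : ∀ x, F x ^ (1 - 1 / (m + 1 : ℕ) : ℝ) = h x + ε)
    (hw : ∀ k x, |h' k x| ≤ Real.sqrt (F x) * w k x)
    (hm : ∫ x in cube (m + 1) L, F x = ∫ x in cube (m + 1) L, G x) {l : ℝ} (hl : 0 < l) :
    ((m + 1 : ℕ) : ℝ) * ∫ x in cube (m + 1) L, G x ^ (1 - 1 / (m + 1 : ℕ) : ℝ) ≤
      (m + 1 : ℕ) * (2 * ε * L * volume.real (cube m L)) +
      1 / 2 * (l * ∫ x in cube (m + 1) L, ∑ k, w k x ^ 2) +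
      1 / 2 * (l⁻¹ * ∫ x in cube (m + 1) L, (∑ k, x k ^ 2) * G x) := by
  obtain ⟨T, D, hTm, hDm, hTc, ⟨M, hM⟩, hprod, hder, hpush⟩ :=
    exists_knothe_map hL (m + 1) F G hF hG hFb hGb hm
  obtain ⟨cF, CF, hcF, hFb⟩ := hFb
  obtain ⟨cG, CG, hcG, hGb⟩ := hGb
  have hF0 : ∀ x, 0 < F x := fun x => hcF.trans_le (hFb x).1
  have hG0 : ∀ x, 0 < G x := fun x => hcG.trans_le (hGb x).1
  have hTk : ∀ k, Measurable fun x => T x k := fun k => (measurable_pi_apply k).comp hTm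
  have hDk : ∀ k, Measurable fun x => D x k := fun k => (measurable_pi_apply k).comp hDm
  have hTL : ∀ k, ∀ x ∈ cube (m + 1) L, |T x k| ≤ L := fun k x hx =>
    abs_le.2 (hTc x hx k (Set.mem_univ k))
  have hDM : ∀ k x, |D x k| ≤ M := fun k x => by
    rw [abs_of_nonneg (hM x k).1]; exact (hM x k).2
  have hpow : (fun x => G x ^ (1 - 1 / (m + 1 : ℕ) : ℝ)) =
      fun x => G x ^ (-(1 / (m + 1 : ℕ)) : ℝ) * G x := funext fun x => by
    rw [sub_eq_neg_add, Real.rpow_add (hG0 x), Real.rpow_one]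
  have hφ : Continuous fun x => G x ^ (-(1 / (m + 1 : ℕ)) : ℝ) :=
    hG.rpow_const fun x => Or.inl (hG0 x).ne'
  have hsq : Continuous fun x : Fin (m + 1) → ℝ => ∑ k, x k ^ 2 := by fun_prop
  have hintg : ∀ {H : (Fin (m + 1) → ℝ) → ℝ}, Continuous H → IntegrableOn H (cube (m + 1) L) :=
    fun hH => hH.continuousOn.integrableOn_compact (isCompact_cube _ _)
  have hintgT : ∀ {H : (Fin (m + 1) → ℝ) → ℝ}, Continuous H →
      IntegrableOn (fun x => H (T x) * F x) (cube (m + 1) L) := fun {H} hH => by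
    obtain ⟨B, hB⟩ := (isCompact_cube (m + 1) L).exists_bound_of_continuousOn hH.continuousOn
    refine integrableOn_cube_of_bound ((hH.measurable.comp hTm).mul hF.measurable)
      (M := B * CF) fun x hx => ?_
    rw [abs_mul]
    refine mul_le_mul (hB _ (hTc x hx)) ?_ (abs_nonneg _) ((norm_nonneg _).trans (hB _ (hTc x hx)))
    rw [abs_of_pos (hF0 x)]; exact (hFb x).2
  have hparts : ∀ k, IntegrableOn (fun x => (h x + ε) * D x k + h' k x * T x k)
      (cube (m + 1) L) := fun k => by
    obtain ⟨B, hB⟩ := (isCompact_cube (m + 1) L).exists_bound_of_continuousOn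
      (f := fun x => h x + ε) (by fun_prop)
    obtain ⟨B', hB'⟩ := (isCompact_cube (m + 1) L).exists_bound_of_continuousOn
      (hc' k).continuousOn
    have := hc' k
    have := hTk k
    have := hDk k
    refine Integrable.add ?_ ?_
    · refine integrableOn_cube_of_bound (M := B * M) (by fun_prop) fun x hx => ?_
      rw [abs_mul]
      exact mul_le_mul (hB x hx) (hDM k x) (abs_nonneg _) ((norm_nonneg _).trans (hB x hx))
    · refine integrableOn_cube_of_bound (M := B' * L) (by fun_prop) fun x hx => ?_
      rw [abs_mul]
      exact mul_le_mul (hB' x hx) (hTL k x hx) (abs_nonneg _) ((norm_nonneg _).trans (hB' x hx))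
  have hbyparts : ∑ k, ∫ x in cube (m + 1) L, ((h x + ε) * D x k + h' k x * T x k) ≤
      (m + 1 : ℕ) * (2 * ε * L * volume.real (cube m L)) := by
    calc _ ≤ ∑ k : Fin (m + 1), 2 * ε * L * volume.real (cube m L) :=
          Finset.sum_le_sum fun k _ => (le_abs_self _).trans
            (abs_setIntegral_cube_add_mul_deriv_le hL hε k hc (hc' k) (hd k) (hbd k) (hTk k)
              (hDk k) (hTL k) (hDM k) (fun x t => hder x k t))
      _ = _ := by simp
  rw [hpow, ← hpush _ hφ, ← hpush _ hsq]
  rw [← integral_finsetSum _ fun k _ => hparts k] at hbyparts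
  have hwint : IntegrableOn (fun x => ∑ k, w k x ^ 2) (cube (m + 1) L) :=
    hintg (continuous_finsetSum _ fun k _ => (hwc k).pow 2)
  have hwint' : IntegrableOn (fun x => 1 / 2 * (l * ∑ k, w k x ^ 2)) (cube (m + 1) L) :=
    (hwint.const_mul l).const_mul _
  have hTint : IntegrableOn (fun x => 1 / 2 * (l⁻¹ * ((∑ k, T x k ^ 2) * F x))) (cube (m + 1) L) :=
    ((hintgT hsq).const_mul _).const_mul _
  have hsum : IntegrableOn (fun x => 1 / 2 * (l * ∑ k, w k x ^ 2) +
      1 / 2 * (l⁻¹ * ((∑ k, T x k ^ 2) * F x))) (cube (m + 1) L) := hwint'.add hTint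
  have hmono : ∫ x in cube (m + 1) L, ((m + 1 : ℕ) * (G (T x) ^ (-(1 / (m + 1 : ℕ)) : ℝ) * F x)) ≤
      ∫ x in cube (m + 1) L, (∑ k, ((h x + ε) * D x k + h' k x * T x k) +
        (1 / 2 * (l * ∑ k, w k x ^ 2) + 1 / 2 * (l⁻¹ * ((∑ k, T x k ^ 2) * F x)))) := by
    refine setIntegral_mono_on ((hintgT hφ).const_mul _) ?_ (measurableSet_cube _ _) fun x hx => ?_
    · exact (integrable_finsetSum _ fun k _ => hparts k).add hsum
    · have h1 := mul_rpow_le_sum_of_prod_mul_eq (Nat.succ_pos m) (fun k => (hM x k).1) (hF0 x)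
        (hG0 (T x)) (hprod x)
      rw [hFh] at h1
      refine h1.trans ?_
      have h2 : 0 ≤ ∑ k, (h' k x * T x k + (1 / 2 * (l * w k x ^ 2) +
          1 / 2 * (l⁻¹ * (T x k ^ 2 * F x)))) := by
        refine Finset.sum_nonneg fun k _ => ?_
        have h3 : |h' k x * T x k| ≤ Real.sqrt (F x) * w k x * |T x k| := by
          rw [abs_mul]; exact mul_le_mul_of_nonneg_right (hw k x) (abs_nonneg _)
        have h4 := neg_abs_le (h' k x * T x k)
        have h5 : l * l⁻¹ = 1 := mul_inv_cancel₀ hl.ne'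
        have h6 := Real.sq_sqrt (hF0 x).le
        have h7 : 0 ≤ l⁻¹ * (l * w k x - |T x k| * Real.sqrt (F x)) ^ 2 := by positivity
        have h8 : l⁻¹ * (l * w k x - |T x k| * Real.sqrt (F x)) ^ 2 =
            l * w k x ^ 2 - 2 * (Real.sqrt (F x) * w k x * |T x k|) +
            l⁻¹ * (T x k ^ 2 * F x) := by
          rw [← sq_abs (T x k)]
          generalize Real.sqrt (F x) = r at *
          rw [← h6]
          field_simp
          ring
        linarith
      have h9 : ∑ k, (h' k x * T x k + (1 / 2 * (l * w k x ^ 2) +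
          1 / 2 * (l⁻¹ * (T x k ^ 2 * F x)))) = ∑ k, h' k x * T x k +
          (1 / 2 * (l * ∑ k, w k x ^ 2) + 1 / 2 * (l⁻¹ * ((∑ k, T x k ^ 2) * F x))) := by
        simp only [Finset.sum_add_distrib, Finset.mul_sum, Finset.sum_mul]
      rw [Finset.sum_add_distrib, ← Finset.mul_sum]
      linarith
  rw [integral_const_mul, integral_add (integrable_finsetSum _ fun k _ => hparts k)
      hsum, integral_add hwint' hTint,
    integral_const_mul, integral_const_mul, integral_const_mul, integral_const_mul] at hmono
  linarith

theorem transport_inequality_cube_of_nonneg {m : ℕ} (hm0 : 0 < m) {L : ℝ} (hL : 0 < L)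
    {h : (Fin (m + 1) → ℝ) → ℝ} {h' : Fin (m + 1) → (Fin (m + 1) → ℝ) → ℝ}
    {w : Fin (m + 1) → (Fin (m + 1) → ℝ) → ℝ} {g : (Fin (m + 1) → ℝ) → ℝ} {p : ℝ}
    (hp : p * (1 - 1 / (m + 1 : ℕ) : ℝ) = 1)
    (hc : Continuous h) (hc' : ∀ k, Continuous (h' k)) (hwc : ∀ k, Continuous (w k))
    (hh0 : ∀ x, 0 ≤ h x) {B : ℝ} (hB : ∀ x, h x ≤ B) (hw0 : ∀ k x, 0 ≤ w k x)
    (hd : ∀ k x t, HasDerivAt (fun s => h (Function.update x k s))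
      (h' k (Function.update x k t)) t)
    (hbd : ∀ k x, |x k| = L → h x = 0)
    (hw : ∀ k x, |h' k x| ≤ Real.sqrt (h x ^ p) * w k x)
    (hg : Continuous g) (hg0 : ∀ x, 0 < g x) {C : ℝ} (hgC : ∀ x, g x ≤ C) {l : ℝ} (hl : 0 < l) :
    ((m + 1 : ℕ) : ℝ) * (((∫ x in cube (m + 1) L, h x ^ p) / ∫ x in cube (m + 1) L, g x) ^
        (1 - 1 / (m + 1 : ℕ) : ℝ) * ∫ x in cube (m + 1) L, g x ^ (1 - 1 / (m + 1 : ℕ) : ℝ)) ≤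
      1 / 2 * (l * ∫ x in cube (m + 1) L, ∑ k, w k x ^ 2) +
      1 / 2 * (l⁻¹ * (((∫ x in cube (m + 1) L, h x ^ p) / ∫ x in cube (m + 1) L, g x) *
        ∫ x in cube (m + 1) L, (∑ k, x k ^ 2) * g x)) := by
  have hr : 0 < (1 - 1 / (m + 1 : ℕ) : ℝ) := by
    have : (1 : ℝ) < (m + 1 : ℕ) := by exact_mod_cast Nat.succ_lt_succ hm0
    rw [sub_pos, div_lt_one (by linarith)]; exact this
  set r : ℝ := (1 - 1 / (m + 1 : ℕ) : ℝ) with hr'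
  have hp0 : 0 < p := by
    by_contra hcon
    nlinarith [mul_nonneg (neg_nonneg.2 (not_lt.1 hcon)) hr.le]
  have hintg : ∀ {H : (Fin (m + 1) → ℝ) → ℝ}, Continuous H → IntegrableOn H (cube (m + 1) L) :=
    fun hH => hH.continuousOn.integrableOn_compact (isCompact_cube _ _)
  have hvol : 0 < volume (cube (m + 1) L) := by
    rw [cube, volume_pi_pi]
    refine pos_iff_ne_zero.2 (Finset.prod_ne_zero_iff.2 fun i _ => ?_)
    simpa using hL
  have hposint : ∀ {H : (Fin (m + 1) → ℝ) → ℝ}, Continuous H → (∀ x, 0 < H x) →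
      0 < ∫ x in cube (m + 1) L, H x := fun {H} hH hH0 => by
    rw [setIntegral_pos_iff_support_of_nonneg_ae
      (Filter.Eventually.of_forall fun x => (hH0 x).le) (hintg hH)]
    rwa [show Function.support H = Set.univ from Set.eq_univ_of_forall fun x => (hH0 x).ne',
      Set.univ_inter]
  set I := ∫ x in cube (m + 1) L, g x with hI
  have hI0 : 0 < I := hposint hg hg0
  obtain ⟨x0, -, hx0⟩ := (isCompact_cube (m + 1) L).exists_isMinOn
    ⟨0, fun i _ => by simp [hL.le]⟩ hg.continuousOn
  set a : ℝ → ℝ := fun ε => (∫ x in cube (m + 1) L, (h x + ε) ^ p) / I with ha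
  have hac : Continuous a := by
    refine (continuous_parametric_integral_of_continuous
      (f := fun (ε : ℝ) x => (h x + ε) ^ p) ?_ (isCompact_cube (m + 1) L)).div_const I
    exact Continuous.rpow_const (by fun_prop) fun _ => Or.inr hp0.le
  have main : ∀ ε : ℝ, 0 < ε → ((m + 1 : ℕ) : ℝ) * (a ε ^ r * ∫ x in cube (m + 1) L, g x ^ r) ≤
      (m + 1 : ℕ) * (2 * ε * L * volume.real (cube m L)) +
      1 / 2 * (l * ∫ x in cube (m + 1) L, ∑ k, w k x ^ 2) +
      1 / 2 * (l⁻¹ * (a ε * ∫ x in cube (m + 1) L, (∑ k, x k ^ 2) * g x)) := by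
    intro ε hε
    have hhε : ∀ x, 0 < h x + ε := fun x => by linarith [hh0 x]
    have hFc : Continuous fun x => (h x + ε) ^ p :=
      (hc.add continuous_const).rpow_const fun x => Or.inl (hhε x).ne'
    have hF0 : ∀ x, 0 < (h x + ε) ^ p := fun x => Real.rpow_pos_of_pos (hhε x) p
    have ha0 : 0 < a ε := div_pos (hposint hFc hF0) hI0
    have hGg : ∀ x ∈ cube (m + 1) L, a ε * max (g x) (g x0) = a ε * g x := fun x hx => by
      rw [max_eq_left (hx0 hx)]
    have key := transport_inequality_cube (F := fun x => (h x + ε) ^ p)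
      (G := fun x => a ε * max (g x) (g x0)) hL hε hc hc' hwc hd hbd hFc
      (continuous_const.mul (hg.max continuous_const))
      ⟨ε ^ p, (B + ε) ^ p, Real.rpow_pos_of_pos hε p, fun x =>
        ⟨Real.rpow_le_rpow hε.le (by linarith [hh0 x]) hp0.le,
          Real.rpow_le_rpow (hhε x).le (by linarith [hB x]) hp0.le⟩⟩
      ⟨a ε * g x0, a ε * C, mul_pos ha0 (hg0 _), fun x =>
        ⟨mul_le_mul_of_nonneg_left (le_max_right _ _) ha0.le,
          mul_le_mul_of_nonneg_left (max_le (hgC _) (hgC _)) ha0.le⟩⟩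
      (fun x => by rw [← Real.rpow_mul (hhε x).le, hp, Real.rpow_one])
      (fun k x => (hw k x).trans (mul_le_mul_of_nonneg_right (Real.sqrt_le_sqrt
        (Real.rpow_le_rpow (hh0 x) (by linarith) hp0.le)) (hw0 k x)))
      (by
        rw [setIntegral_congr_fun (measurableSet_cube _ _) hGg, integral_const_mul]
        exact (div_mul_cancel₀ _ hI0.ne').symm) hl
    have e1 : ∫ x in cube (m + 1) L, (a ε * max (g x) (g x0)) ^ r =
        a ε ^ r * ∫ x in cube (m + 1) L, g x ^ r := by
      rw [← integral_const_mul]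
      refine setIntegral_congr_fun (measurableSet_cube _ _) fun x hx => ?_
      simp only [hGg x hx]
      exact Real.mul_rpow ha0.le (hg0 x).le
    have e2 : ∫ x in cube (m + 1) L, (∑ k, x k ^ 2) * (a ε * max (g x) (g x0)) =
        a ε * ∫ x in cube (m + 1) L, (∑ k, x k ^ 2) * g x := by
      rw [← integral_const_mul]
      refine setIntegral_congr_fun (measurableSet_cube _ _) fun x hx => ?_
      simp only [hGg x hx]
      ring
    rw [e1, e2] at key
    exact key
  have hlim1 : Filter.Tendsto (fun ε => ((m + 1 : ℕ) : ℝ) *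
      (a ε ^ r * ∫ x in cube (m + 1) L, g x ^ r)) (nhdsWithin 0 (Set.Ioi 0))
      (nhds (((m + 1 : ℕ) : ℝ) * (a 0 ^ r * ∫ x in cube (m + 1) L, g x ^ r))) := by
    have : Continuous fun ε => ((m + 1 : ℕ) : ℝ) * (a ε ^ r * ∫ x in cube (m + 1) L, g x ^ r) :=
      continuous_const.mul ((hac.rpow_const fun _ => Or.inr hr.le).mul continuous_const)
    exact (this.tendsto 0).mono_left nhdsWithin_le_nhds
  have hlim2 : Filter.Tendsto (fun ε => (m + 1 : ℕ) * (2 * ε * L * volume.real (cube m L)) +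
      1 / 2 * (l * ∫ x in cube (m + 1) L, ∑ k, w k x ^ 2) +
      1 / 2 * (l⁻¹ * (a ε * ∫ x in cube (m + 1) L, (∑ k, x k ^ 2) * g x)))
      (nhdsWithin 0 (Set.Ioi 0))
      (nhds ((m + 1 : ℕ) * (2 * 0 * L * volume.real (cube m L)) +
      1 / 2 * (l * ∫ x in cube (m + 1) L, ∑ k, w k x ^ 2) +
      1 / 2 * (l⁻¹ * (a 0 * ∫ x in cube (m + 1) L, (∑ k, x k ^ 2) * g x)))) := by
    have : Continuous fun ε => (m + 1 : ℕ) * (2 * ε * L * volume.real (cube m L)) +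
      1 / 2 * (l * ∫ x in cube (m + 1) L, ∑ k, w k x ^ 2) +
      1 / 2 * (l⁻¹ * (a ε * ∫ x in cube (m + 1) L, (∑ k, x k ^ 2) * g x)) := by fun_prop
    exact (this.tendsto 0).mono_left nhdsWithin_le_nhds
  have hfin := le_of_tendsto_of_tendsto hlim1 hlim2
    (Filter.eventually_of_mem self_mem_nhdsWithin fun ε hε => main ε hε)
  simpa [ha] using hfin

theorem tendsto_setIntegral_cube {n : ℕ} {H : (Fin n → ℝ) → ℝ} (hH : Integrable H) :
    Filter.Tendsto (fun j : ℕ => ∫ x in cube n j, H x) Filter.atTop (nhds (∫ x, H x)) := by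
  have hmono : Monotone fun j : ℕ => cube n (j : ℝ) := fun i j hij =>
    Set.pi_mono fun _ _ => Set.Icc_subset_Icc (by simpa using hij) (by simpa using hij)
  have hU : (⋃ j : ℕ, cube n (j : ℝ)) = Set.univ := by
    refine Set.eq_univ_of_forall fun x => Set.mem_iUnion.2 ?_
    obtain ⟨j, hj⟩ := exists_nat_ge ‖x‖
    exact ⟨j, fun i _ => abs_le.1 ((norm_le_pi_norm x i).trans hj)⟩
  have := tendsto_setIntegral_of_monotone (fun j : ℕ => measurableSet_cube n (j : ℝ)) hmono
    (f := H) (by rw [hU]; exact hH.integrableOn)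
  rwa [hU, Measure.restrict_univ] at this

/-- Transport inequality on the whole space. -/
theorem transport_inequality {m : ℕ} (hm0 : 0 < m)
    {h : (Fin (m + 1) → ℝ) → ℝ} {h' : Fin (m + 1) → (Fin (m + 1) → ℝ) → ℝ}
    {w : Fin (m + 1) → (Fin (m + 1) → ℝ) → ℝ} {g : (Fin (m + 1) → ℝ) → ℝ} {p : ℝ}
    (hp : p * (1 - 1 / (m + 1 : ℕ) : ℝ) = 1)
    (hc : Continuous h) (hc' : ∀ k, Continuous (h' k)) (hwc : ∀ k, Continuous (w k))
    (hh0 : ∀ x, 0 ≤ h x) (hw0 : ∀ k x, 0 ≤ w k x)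
    (hd : ∀ k x t, HasDerivAt (fun s => h (Function.update x k s))
      (h' k (Function.update x k t)) t)
    (hsupp : HasCompactSupport h)
    (hw : ∀ k x, |h' k x| ≤ Real.sqrt (h x ^ p) * w k x)
    (hwi : Integrable fun x => ∑ k, w k x ^ 2) (hhi : Integrable fun x => h x ^ p)
    (hg : Continuous g) (hg0 : ∀ x, 0 < g x) {C : ℝ} (hgC : ∀ x, g x ≤ C)
    (hgi : Integrable g) (hgi' : Integrable fun x => g x ^ (1 - 1 / (m + 1 : ℕ) : ℝ))
    (hgi2 : Integrable fun x => (∑ k, x k ^ 2) * g x) {l : ℝ} (hl : 0 < l) :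
    ((m + 1 : ℕ) : ℝ) * (((∫ x, h x ^ p) / ∫ x, g x) ^
        (1 - 1 / (m + 1 : ℕ) : ℝ) * ∫ x, g x ^ (1 - 1 / (m + 1 : ℕ) : ℝ)) ≤
      1 / 2 * (l * ∫ x, ∑ k, w k x ^ 2) +
      1 / 2 * (l⁻¹ * (((∫ x, h x ^ p) / ∫ x, g x) * ∫ x, (∑ k, x k ^ 2) * g x)) := by
  obtain ⟨B, hB⟩ := hc.bounded_above_of_compact_support hsupp
  obtain ⟨R, hR⟩ := hsupp.isCompact.isBounded.subset_closedBall 0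
  have hr : 0 ≤ (1 - 1 / (m + 1 : ℕ) : ℝ) := by
    have : (1 : ℝ) < (m + 1 : ℕ) := by exact_mod_cast Nat.succ_lt_succ hm0
    rw [sub_nonneg, div_le_one (by linarith)]; exact this.le
  have hI0 : (∫ x, g x) ≠ 0 := by
    refine ne_of_gt ((integral_pos_iff_support_of_nonneg (fun x => (hg0 x).le) hgi).2 ?_)
    rw [show Function.support g = Set.univ from Set.eq_univ_of_forall fun x => (hg0 x).ne']
    simp
  have hq := (tendsto_setIntegral_cube hhi).div (tendsto_setIntegral_cube hgi) hI0
  refine le_of_tendsto_of_tendsto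
    (((hq.rpow_const (Or.inr hr)).mul (tendsto_setIntegral_cube hgi')).const_mul _)
    ((((tendsto_setIntegral_cube hwi).const_mul l).const_mul (1 / 2)).add
      (((hq.mul (tendsto_setIntegral_cube hgi2)).const_mul l⁻¹).const_mul (1 / 2))) ?_
  obtain ⟨j0, hj0⟩ := exists_nat_gt (max R 0)
  filter_upwards [Filter.eventually_ge_atTop j0] with j hj
  have hjR : max R 0 < (j : ℝ) := hj0.trans_le (by exact_mod_cast hj)
  refine transport_inequality_cube_of_nonneg hm0 (lt_of_le_of_lt (le_max_right R 0) hjR) hp hc hc'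
    hwc hh0 (fun x => (le_abs_self _).trans (hB x)) hw0 hd (fun k x hx => ?_) hw hg hg0 hgC hl
  by_contra hne
  have h1 := hR (subset_tsupport h hne)
  rw [mem_closedBall_zero_iff] at h1
  have h2 := norm_le_pi_norm x k
  rw [Real.norm_eq_abs, hx] at h2
  linarith [le_max_left R 0]

theorem integrable_inv_one_add_norm_sq_pow {d k : ℕ} (hk : d < 2 * k) :
    Integrable fun x : EuclideanSpace ℝ (Fin d) => ((1 + ‖x‖ ^ 2) ^ k)⁻¹ := by
  have h := integrable_rpow_neg_one_add_norm_sq (E := EuclideanSpace ℝ (Fin d))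
    (μ := volume) (r := 2 * k) (by
      rw [finrank_euclideanSpace_fin]
      exact_mod_cast hk)
  refine h.congr (Filter.Eventually.of_forall fun x => ?_)
  have : (0 : ℝ) ≤ 1 + ‖x‖ ^ 2 := by positivity
  change (1 + ‖x‖ ^ 2) ^ (-(2 * (k : ℝ)) / 2) = _
  rw [show -(2 * (k : ℝ)) / 2 = -(k : ℝ) by ring, Real.rpow_neg this, Real.rpow_natCast]

theorem integrable_norm_sq_mul_inv_one_add_norm_sq_pow {d : ℕ} (hd : 3 ≤ d) :
    Integrable fun x : EuclideanSpace ℝ (Fin d) => ‖x‖ ^ 2 * ((1 + ‖x‖ ^ 2) ^ d)⁻¹ := by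
  refine (integrable_inv_one_add_norm_sq_pow (d := d) (k := d - 1) (by lia)).mono'
    (by fun_prop (disch := intros; positivity)) (Filter.Eventually.of_forall fun x => ?_)
  obtain ⟨m, rfl⟩ : ∃ m, d = m + 1 := ⟨d - 1, by lia⟩
  have : 0 < 1 + ‖x‖ ^ 2 := by positivity
  rw [Real.norm_of_nonneg (by positivity), Nat.add_sub_cancel, pow_succ (1 + ‖x‖ ^ 2), mul_inv]
  rw [mul_comm, mul_assoc]
  refine mul_le_of_le_one_right (by positivity) ?_
  rw [inv_mul_le_one₀ this]
  linarith

theorem abs_fderiv_norm_rpow_apply_le {E : Type*} [NormedAddCommGroup E] [NormedSpace ℝ E]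
    {v : E → ℂ} (hv : Differentiable ℝ v) {q : ℝ} (hq : 1 < q) (x e : E) :
    |fderiv ℝ (fun x => ‖v x‖ ^ q) x e| ≤ ‖v x‖ ^ (q - 1) * (q * ‖fderiv ℝ v x e‖) := by
  rw [hv.fderiv_norm_rpow hq]
  simp only [smul_apply, ContinuousLinearMap.comp_apply, smul_eq_mul,
    innerSL_apply_apply, abs_mul, abs_of_pos (zero_lt_one.trans hq)]
  rw [abs_of_nonneg (by positivity : 0 ≤ ‖v x‖ ^ (q - 2))]
  have h1 : ‖v x‖ ^ (q - 1) = ‖v x‖ ^ (q - 2) * ‖v x‖ := by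
    rw [← Real.rpow_add_one' (norm_nonneg _) (by linarith)]
    congr 1; ring
  rw [h1]
  calc _ ≤ q * ‖v x‖ ^ (q - 2) * (‖v x‖ * ‖fderiv ℝ v x e‖) := by
        gcongr
        exact abs_real_inner_le_norm _ _
    _ = _ := by ring

theorem sobolev_transport {m : ℕ} (hm : 2 ≤ m) {v : EuclideanSpace ℝ (Fin (m + 1)) → ℂ}
    (hv : ContDiff ℝ 1 v) (hs : HasCompactSupport v) {l : ℝ} (hl : 0 < l) :
    ((m + 1 : ℕ) : ℝ) * (((∫ x, ‖v x‖ ^ (2 * (m + 1 : ℝ) / (m - 1))) /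
        ∫ x : EuclideanSpace ℝ (Fin (m + 1)), ((1 + ‖x‖ ^ 2) ^ (m + 1))⁻¹) ^
        (1 - 1 / (m + 1 : ℕ) : ℝ) *
        ∫ x : EuclideanSpace ℝ (Fin (m + 1)), ((1 + ‖x‖ ^ 2) ^ m)⁻¹) ≤
      1 / 2 * (l * ((2 * (m : ℝ) / (m - 1)) ^ 2 *
        ∫ x, ∑ k, ‖fderiv ℝ v x (EuclideanSpace.single k 1)‖ ^ 2)) +
      1 / 2 * (l⁻¹ * (((∫ x, ‖v x‖ ^ (2 * (m + 1 : ℝ) / (m - 1))) /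
        ∫ x : EuclideanSpace ℝ (Fin (m + 1)), ((1 + ‖x‖ ^ 2) ^ (m + 1))⁻¹) *
        ∫ x : EuclideanSpace ℝ (Fin (m + 1)), ‖x‖ ^ 2 * ((1 + ‖x‖ ^ 2) ^ (m + 1))⁻¹)) := by
  have hm2 : (2 : ℝ) ≤ m := by exact_mod_cast hm
  have hm1 : (0 : ℝ) < m - 1 := by linarith
  set q : ℝ := 2 * (m : ℝ) / (m - 1) with hq
  have hq1 : 1 < q := by rw [hq, lt_div_iff₀ hm1]; linarith
  have mp := PiLp.volume_preserving_toLp (Fin (m + 1))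
  have me : MeasurableEmbedding (WithLp.toLp 2 : (Fin (m + 1) → ℝ) → _) :=
    (MeasurableEquiv.toLp 2 (Fin (m + 1) → ℝ)).measurableEmbedding
  have hT : Continuous (WithLp.toLp 2 : (Fin (m + 1) → ℝ) → EuclideanSpace ℝ (Fin (m + 1))) :=
    PiLp.continuous_toLp 2 _
  have hnorm : ∀ y : Fin (m + 1) → ℝ,
      ‖(WithLp.toLp 2 y : EuclideanSpace ℝ (Fin (m + 1)))‖ ^ 2 = ∑ k, y k ^ 2 := fun y => by
    rw [EuclideanSpace.norm_sq_eq]; simp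
  have hv1 := hv.continuous_fderiv one_ne_zero
  have hhC : ContDiff ℝ 1 fun x => ‖v x‖ ^ q := hv.norm_rpow hq1
  have hdv := hv.differentiable one_ne_zero
  have hpq : ∀ x, (‖v x‖ ^ q) ^ ((m + 1 : ℝ) / m) = ‖v x‖ ^ (2 * (m + 1 : ℝ) / (m - 1)) := by
    intro x
    rw [← Real.rpow_mul (norm_nonneg _)]
    congr 1
    rw [hq]
    field_simp
  have hcs : ∀ {H : EuclideanSpace ℝ (Fin (m + 1)) → ℝ}, Continuous H → HasCompactSupport H →
      Integrable H := fun h1 h2 => h1.integrable_of_hasCompactSupport h2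
  have hSi : Integrable fun x => ‖v x‖ ^ (2 * (m + 1 : ℝ) / (m - 1)) := by
    have hp : 0 < 2 * (m + 1 : ℝ) / (m - 1) := by positivity
    exact hcs (hv.continuous.norm.rpow_const fun _ => Or.inr hp.le)
      (hs.comp_left (g := fun z : ℂ => ‖z‖ ^ (2 * (m + 1 : ℝ) / (m - 1)))
        (by simp [Real.zero_rpow hp.ne']))
  have hsd : HasCompactSupport (fderiv ℝ v) := hs.fderiv (𝕜 := ℝ)
  have hintg : ∀ {H : EuclideanSpace ℝ (Fin (m + 1)) → ℝ}, Integrable H →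
      Integrable fun y => H (WithLp.toLp 2 y) := fun hH => (mp.integrable_comp_emb me).2 hH
  have hr : ∀ x : EuclideanSpace ℝ (Fin (m + 1)),
      ((1 + ‖x‖ ^ 2) ^ (m + 1))⁻¹ ^ (1 - 1 / (m + 1 : ℕ) : ℝ) = ((1 + ‖x‖ ^ 2) ^ m)⁻¹ := by
    intro x
    have h0 : (0 : ℝ) ≤ 1 + ‖x‖ ^ 2 := by positivity
    rw [Real.inv_rpow (by positivity), ← Real.rpow_natCast, ← Real.rpow_mul h0,
      ← Real.rpow_natCast (1 + ‖x‖ ^ 2) m]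
    congr 2
    push_cast
    rw [mul_sub, mul_one_div_cancel (by positivity)]
    ring
  have hwi : Integrable fun x => ∑ k, (q * ‖fderiv ℝ v x (EuclideanSpace.single k 1)‖) ^ 2 := by
    refine hcs (by fun_prop) (hsd.comp_left (g := fun T :
      EuclideanSpace ℝ (Fin (m + 1)) →L[ℝ] ℂ => ∑ k : Fin (m + 1),
        (q * ‖T (EuclideanSpace.single k 1)‖) ^ 2) ?_)
    simp
  have hsqrt : ∀ x, Real.sqrt (‖v x‖ ^ (2 * (m + 1 : ℝ) / (m - 1))) = ‖v x‖ ^ (q - 1) := by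
    intro x
    rw [Real.sqrt_eq_rpow, ← Real.rpow_mul (norm_nonneg _)]
    congr 1
    rw [hq]
    field_simp
    ring
  have key := transport_inequality (m := m) (by lia) (p := (m + 1 : ℝ) / m)
    (h := fun y => ‖v (WithLp.toLp 2 y)‖ ^ q)
    (h' := fun k y => fderiv ℝ (fun x => ‖v x‖ ^ q) (WithLp.toLp 2 y) (EuclideanSpace.single k 1))
    (w := fun k y => q * ‖fderiv ℝ v (WithLp.toLp 2 y) (EuclideanSpace.single k 1)‖)
    (g := fun y => ((1 + ‖(WithLp.toLp 2 y : EuclideanSpace ℝ (Fin (m + 1)))‖ ^ 2) ^ (m + 1))⁻¹)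
    (by push_cast; field_simp; ring)
    (hhC.continuous.comp hT)
    (fun k => ((hhC.continuous_fderiv one_ne_zero).comp hT).clm_apply continuous_const)
    (fun k => continuous_const.mul ((hv1.comp hT).clm_apply continuous_const).norm)
    (fun y => by positivity) (fun k y => by positivity)
    (fun k y t => by
      have h1 : HasDerivAt (fun s : ℝ =>
          (WithLp.toLp 2 (Function.update y k s) : EuclideanSpace ℝ (Fin (m + 1))))
          (EuclideanSpace.single k 1) t :=
        (PiLp.continuousLinearEquiv 2 ℝ fun _ : Fin (m + 1) => ℝ).symm.hasFDerivAt.comp_hasDerivAt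
          t (hasDerivAt_update y k t)
      exact ((hhC.differentiable one_ne_zero) _).hasFDerivAt.comp_hasDerivAt t h1)
    ((hs.comp_left (g := fun z : ℂ => ‖z‖ ^ q) (by
      simp [Real.zero_rpow (by linarith : q ≠ 0)])).comp_homeomorph
      (PiLp.homeomorph 2 fun _ : Fin (m + 1) => ℝ).symm)
    (fun k y => by
      simp only [hpq]
      rw [hsqrt]
      exact abs_fderiv_norm_rpow_apply_le hdv hq1 _ _)
    (hintg hwi)
    (by
      simp only [hpq]
      exact hintg hSi)
    (by fun_prop (disch := intros; positivity)) (fun y => by positivity)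
    (C := 1) (fun y => inv_le_one_of_one_le₀ (one_le_pow₀ (by
      linarith [sq_nonneg ‖(WithLp.toLp 2 y : EuclideanSpace ℝ (Fin (m + 1)))‖])))
    (hintg (integrable_inv_one_add_norm_sq_pow (by lia)))
    (by
      simp only [hr]
      exact hintg (integrable_inv_one_add_norm_sq_pow (by lia)))
    (by
      simp only [← hnorm]
      exact hintg (integrable_norm_sq_mul_inv_one_add_norm_sq_pow (by lia))) hl
  simp only [hpq, hr] at key
  have tr : ∀ H : EuclideanSpace ℝ (Fin (m + 1)) → ℝ,
      ∫ y : Fin (m + 1) → ℝ, H (WithLp.toLp 2 y) = ∫ x, H x := mp.integral_comp me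
  have tr' : ∫ y : Fin (m + 1) → ℝ, (∑ k, y k ^ 2) *
      ((1 + ‖(WithLp.toLp 2 y : EuclideanSpace ℝ (Fin (m + 1)))‖ ^ 2) ^ (m + 1))⁻¹ =
      ∫ x : EuclideanSpace ℝ (Fin (m + 1)), ‖x‖ ^ 2 * ((1 + ‖x‖ ^ 2) ^ (m + 1))⁻¹ := by
    rw [← tr fun x => ‖x‖ ^ 2 * ((1 + ‖x‖ ^ 2) ^ (m + 1))⁻¹]
    simp only [hnorm]
  rw [tr fun x => ‖v x‖ ^ (2 * (m + 1 : ℝ) / (m - 1)), tr fun x => ((1 + ‖x‖ ^ 2) ^ (m + 1))⁻¹,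
    tr fun x => ((1 + ‖x‖ ^ 2) ^ m)⁻¹, tr',
    tr fun x => ∑ k, (q * ‖fderiv ℝ v x (EuclideanSpace.single k 1)‖) ^ 2] at key
  rw [← integral_const_mul (q ^ 2)]
  simpa only [Finset.mul_sum, mul_pow] using key

theorem sq_le_mul_of_forall_le_half_mul_add {X P R : ℝ} (hX : 0 ≤ X) (hP : 0 ≤ P) (hR : 0 ≤ R)
    (h : ∀ l : ℝ, 0 < l → X ≤ 1 / 2 * (l * P) + 1 / 2 * (l⁻¹ * R)) : X ^ 2 ≤ P * R := by
  rcases hX.eq_or_lt with rfl | hX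
  · simpa using mul_nonneg hP hR
  have hε : ∀ ε : ℝ, 0 < ε → X ^ 2 ≤ (P + ε) * R := by
    intro ε hε
    have hPε : 0 < P + ε := by linarith
    have h1 := h (X / (P + ε)) (by positivity)
    have h2 : X / (P + ε) * P ≤ X := by
      rw [div_mul_eq_mul_div, div_le_iff₀ hPε]; nlinarith
    have h3 : X ≤ (X / (P + ε))⁻¹ * R := by linarith
    rw [inv_div, div_mul_eq_mul_div, le_div_iff₀ hX] at h3
    linarith
  have hlim : Filter.Tendsto (fun ε : ℝ => (P + ε) * R) (nhdsWithin 0 (Set.Ioi 0))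
      (nhds ((P + 0) * R)) :=
    ((by fun_prop : Continuous fun ε : ℝ => (P + ε) * R).tendsto 0).mono_left nhdsWithin_le_nhds
  rw [add_zero] at hlim
  exact ge_of_tendsto hlim (Filter.eventually_of_mem self_mem_nhdsWithin fun ε h => hε ε h)

theorem integral_bubble_relation {m : ℕ} (hm : 2 ≤ m) :
    (m + 1 : ℝ) * ∫ x : EuclideanSpace ℝ (Fin (m + 1)), ((1 + ‖x‖ ^ 2) ^ (m + 1))⁻¹ =
      (m - 1 : ℝ) * ∫ x : EuclideanSpace ℝ (Fin (m + 1)),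
        ‖x‖ ^ 2 * ((1 + ‖x‖ ^ 2) ^ (m + 1))⁻¹ := by
  have hI := integrable_inv_one_add_norm_sq_pow (d := m + 1) (k := m + 1) (by lia)
  have hJ := integrable_norm_sq_mul_inv_one_add_norm_sq_pow (d := m + 1) (by lia)
  rw [← sub_eq_zero, ← integral_const_mul, ← integral_const_mul,
    ← integral_sub (hI.const_mul _) (hJ.const_mul _)]
  have hintg := (hI.const_mul (m + 1 : ℝ)).sub (hJ.const_mul (m - 1 : ℝ))
  have hr := (integrable_fun_norm_addHaar (E := EuclideanSpace ℝ (Fin (m + 1))) volume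
    (f := fun r : ℝ => (m + 1 : ℝ) * ((1 + r ^ 2) ^ (m + 1))⁻¹ -
      (m - 1 : ℝ) * (r ^ 2 * ((1 + r ^ 2) ^ (m + 1))⁻¹))).1 hintg
  have hr2 := integral_fun_norm_addHaar (E := EuclideanSpace ℝ (Fin (m + 1))) volume
    (fun r : ℝ => (m + 1 : ℝ) * ((1 + r ^ 2) ^ (m + 1))⁻¹ -
      (m - 1 : ℝ) * (r ^ 2 * ((1 + r ^ 2) ^ (m + 1))⁻¹))
  rw [hr2]
  rw [finrank_euclideanSpace_fin] at hr ⊢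
  have hd : ∀ r : ℝ, HasDerivAt (fun r : ℝ => r ^ (m + 1) * ((1 + r ^ 2) ^ m)⁻¹)
      (r ^ (m + 1 - 1) • ((m + 1 : ℝ) * ((1 + r ^ 2) ^ (m + 1))⁻¹ -
      (m - 1 : ℝ) * (r ^ 2 * ((1 + r ^ 2) ^ (m + 1))⁻¹))) r := by
    intro r
    have h0 : 1 + r ^ 2 ≠ 0 := by positivity
    have h1 := (hasDerivAt_pow (m + 1) r).mul
      ((((hasDerivAt_pow 2 r).const_add 1).pow m).inv (pow_ne_zero m h0))
    refine h1.congr_deriv ?_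
    obtain ⟨k, rfl⟩ : ∃ k, m = k + 1 := ⟨m - 1, by lia⟩
    simp only [smul_eq_mul, Nat.add_sub_cancel]
    push_cast
    simp only [Pi.pow_apply, Pi.inv_apply]
    field_simp
    ring
  have ht : Filter.Tendsto (fun r : ℝ => r ^ (m + 1) * ((1 + r ^ 2) ^ m)⁻¹) Filter.atTop
      (nhds 0) := by
    refine squeeze_zero' (g := fun r : ℝ => r⁻¹) ?_ ?_ tendsto_inv_atTop_zero
    · filter_upwards [Filter.eventually_gt_atTop 0] with r hr
      positivity
    · filter_upwards [Filter.eventually_ge_atTop 1] with r hr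
      have hr0 : 0 < r := by linarith
      rw [← div_eq_mul_inv, div_le_iff₀ (by positivity), inv_mul_eq_div, le_div_iff₀ hr0]
      calc r ^ (m + 1) * r = r ^ (m + 2) := by ring
        _ ≤ r ^ (2 * m) := pow_le_pow_right₀ hr (by lia)
        _ = (r ^ 2) ^ m := by rw [pow_mul]
        _ ≤ _ := by gcongr; linarith
  have := integral_Ioi_of_hasDerivAt_of_tendsto (a := 0) (hd 0).continuousAt.continuousWithinAt
    (fun r _ => hd r) hr ht
  rw [this]
  simp

theorem integral_bubble_pow {m : ℕ} (hm : 2 ≤ m) :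
    ∫ x : EuclideanSpace ℝ (Fin (m + 1)), ((1 + ‖x‖ ^ 2) ^ m)⁻¹ =
      (∫ x : EuclideanSpace ℝ (Fin (m + 1)), ((1 + ‖x‖ ^ 2) ^ (m + 1))⁻¹) +
      ∫ x : EuclideanSpace ℝ (Fin (m + 1)), ‖x‖ ^ 2 * ((1 + ‖x‖ ^ 2) ^ (m + 1))⁻¹ := by
  rw [← integral_add (integrable_inv_one_add_norm_sq_pow (by lia))
    (integrable_norm_sq_mul_inv_one_add_norm_sq_pow (by lia))]
  congr 1
  ext x
  have : 1 + ‖x‖ ^ 2 ≠ 0 := by positivity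
  field_simp
  ring

theorem integral_bubble_pos {d : ℕ} (hd : 1 ≤ d) :
    0 < ∫ x : EuclideanSpace ℝ (Fin d), ((1 + ‖x‖ ^ 2) ^ d)⁻¹ := by
  rw [integral_pos_iff_support_of_nonneg (fun x => by positivity)
    (integrable_inv_one_add_norm_sq_pow (by lia))]
  rw [show Function.support (fun x : EuclideanSpace ℝ (Fin d) => ((1 + ‖x‖ ^ 2) ^ d)⁻¹) =
    Set.univ from Set.eq_univ_of_forall fun x => by
      rw [Function.mem_support]; positivity]
  exact NeZero.pos (volume Set.univ)

/-- The sharp Sobolev inequality, with the constant attained by the Aubin–Talenti bubble. -/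
theorem sharp_sobolev {d : ℕ} (hd : 3 ≤ d) {v : EuclideanSpace ℝ (Fin d) → ℂ}
    (hv : ContDiff ℝ 1 v) (hs : HasCompactSupport v) {I : ℝ}
    (hI : I = ∫ x : EuclideanSpace ℝ (Fin d), ((1 + ‖x‖ ^ 2) ^ d)⁻¹) :
    ∫ x, ‖v x‖ ^ (2 * (d : ℝ) / (d - 2)) ≤
      I * ((∫ x, ∑ k, ‖fderiv ℝ v x (EuclideanSpace.single k 1)‖ ^ 2) /
        (d * (d - 2) * I)) ^ ((d : ℝ) / (d - 2)) := by
  obtain ⟨m, rfl⟩ : ∃ m, d = m + 1 := ⟨d - 1, by lia⟩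
  have hm : 2 ≤ m := by lia
  have hm2 : (2 : ℝ) ≤ m := by exact_mod_cast hm
  have hm1 : (0 : ℝ) < m - 1 := by linarith
  have hI0 : 0 < I := hI ▸ integral_bubble_pos (by lia)
  have hrel := integral_bubble_relation hm
  have hN := integral_bubble_pow hm
  have key := fun l hl => sobolev_transport hm hv hs (l := l) hl
  have e : ((m + 1 : ℕ) : ℝ) - 2 = m - 1 := by push_cast; ring
  rw [e]
  push_cast at *
  set S := ∫ x, ‖v x‖ ^ (2 * (m + 1 : ℝ) / (m - 1)) with hS
  set G := ∫ x, ∑ k, ‖fderiv ℝ v x (EuclideanSpace.single k 1)‖ ^ 2 with hG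
  set J := ∫ x : EuclideanSpace ℝ (Fin (m + 1)), ‖x‖ ^ 2 * ((1 + ‖x‖ ^ 2) ^ (m + 1))⁻¹ with hJ
  rw [← hI] at hrel hN key
  rw [hN] at key
  have hS0 : 0 ≤ S := integral_nonneg fun x => by positivity
  have hG0 : 0 ≤ G := integral_nonneg fun x => by positivity
  have hJ0 : 0 < J := by
    by_contra hcon
    nlinarith [mul_nonneg hm1.le (neg_nonneg.2 (not_lt.1 hcon))]
  rcases hS0.eq_or_lt with h0 | hSpos
  · rw [← h0]; positivity
  have ha : 0 < S / I := by positivity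
  have hsq := sq_le_mul_of_forall_le_half_mul_add (by positivity) (by positivity) (by positivity)
    key
  have hexp : ((S / I) ^ (1 - 1 / (m + 1) : ℝ)) ^ 2 =
      (S / I) ^ ((m - 1) / (m + 1) : ℝ) * (S / I) := by
    rw [← Real.rpow_natCast, ← Real.rpow_mul ha.le, ← Real.rpow_add_one ha.ne']
    congr 1
    push_cast
    field_simp
    ring
  set T := (S / I) ^ ((m - 1) / (m + 1) : ℝ) with hT
  have hIJ : I = (m - 1) * J / (m + 1) := by field_simp; linarith
  have hT1 : T ≤ G / ((m + 1) * (m - 1) * I) := by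
    rw [mul_pow, mul_pow, hexp] at hsq
    rw [le_div_iff₀ (by positivity)]
    have h1 : T * ((m + 1 : ℝ) * (m - 1) * I) * ((4 * m ^ 2 * J / (m - 1) ^ 2) * (S / I)) ≤
        G * ((4 * m ^ 2 * J / (m - 1) ^ 2) * (S / I)) := by
      calc _ = (m + 1 : ℝ) ^ 2 * (T * (S / I) * (I + J) ^ 2) := by
            generalize S / I = b
            rw [hIJ]
            field_simp
            ring
        _ ≤ _ := hsq
        _ = _ := by
            generalize S / I = b
            field_simp
            ring
    exact le_of_mul_le_mul_right h1 (by positivity)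
  have hST : S = I * T ^ ((m + 1 : ℝ) / (m - 1)) := by
    rw [hT, ← Real.rpow_mul ha.le, show (m - 1 : ℝ) / (m + 1) * ((m + 1) / (m - 1)) = 1 by
      field_simp, Real.rpow_one]
    field_simp
  rw [hST]
  gcongr

theorem apply_eq_sum_single {d : ℕ} {F : Type*} [NormedAddCommGroup F] [NormedSpace ℝ F]
    (L : EuclideanSpace ℝ (Fin d) →L[ℝ] F) (x : EuclideanSpace ℝ (Fin d)) :
    L x = ∑ k, x k • L (EuclideanSpace.single k 1) := by
  have hx : x = ∑ k, x k • EuclideanSpace.single k (1 : ℝ) := by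
    simpa using ((EuclideanSpace.basisFun (Fin d) ℝ).sum_repr x).symm
  conv_lhs => rw [hx, map_sum]
  simp

theorem integral_fderiv_apply_self {d : ℕ} {ψ : EuclideanSpace ℝ (Fin d) → ℝ}
    (hψ : ContDiff ℝ 1 ψ) (hs : HasCompactSupport ψ) :
    ∫ x, fderiv ℝ ψ x x = -(d : ℝ) * ∫ x, ψ x := by
  have hc := hψ.continuous_fderiv one_ne_zero
  have hsd : HasCompactSupport (fderiv ℝ ψ) := hs.fderiv (𝕜 := ℝ)
  have hsk : ∀ k, HasCompactSupport fun x => fderiv ℝ ψ x (EuclideanSpace.single k 1) := fun k =>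
    hsd.comp_left (g := fun T : EuclideanSpace ℝ (Fin d) →L[ℝ] ℝ =>
      T (EuclideanSpace.single k 1)) rfl
  have hi : ∀ k : Fin d, Integrable fun x : EuclideanSpace ℝ (Fin d) =>
      x k * fderiv ℝ ψ x (EuclideanSpace.single k 1) := fun k =>
    Continuous.integrable_of_hasCompactSupport (by fun_prop) (hsk k).mul_left
  have hexp : ∀ x : EuclideanSpace ℝ (Fin d), fderiv ℝ ψ x x =
      ∑ k, x k * fderiv ℝ ψ x (EuclideanSpace.single k 1) := fun x => by
    simpa only [smul_eq_mul] using apply_eq_sum_single (fderiv ℝ ψ x) x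
  have hk : ∀ k : Fin d, ∫ x : EuclideanSpace ℝ (Fin d),
      x k * fderiv ℝ ψ x (EuclideanSpace.single k 1) = - ∫ x, ψ x := by
    intro k
    have hf : ∀ x : EuclideanSpace ℝ (Fin d),
        fderiv ℝ (fun x : EuclideanSpace ℝ (Fin d) => x k) x (EuclideanSpace.single k 1) = 1 := by
      intro x
      rw [show (fun x : EuclideanSpace ℝ (Fin d) => x k) = EuclideanSpace.proj (𝕜 := ℝ) k from rfl,
        ContinuousLinearMap.fderiv]
      simp
    have := integral_mul_fderiv_eq_neg_fderiv_mul_of_integrable (μ := volume)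
      (f := fun x : EuclideanSpace ℝ (Fin d) => x k) (g := ψ) (v := EuclideanSpace.single k 1)
      (by simpa only [hf, one_mul] using hψ.continuous.integrable_of_hasCompactSupport hs)
      (hi k) (Continuous.integrable_of_hasCompactSupport
        (by have := hψ.continuous; fun_prop) hs.mul_left)
      (fun x _ => by fun_prop) (fun x _ => hψ.differentiable one_ne_zero x)
    rw [this]
    simp only [hf, one_mul]
  simp only [hexp]
  rw [integral_finsetSum _ fun k _ => hi k]
  simp [hk]

theorem continuous_of_continuousAt_of_notMem_tsupport {E F G : Type*} [TopologicalSpace E] [Zero E]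
    [TopologicalSpace F] [Zero F] [Zero G] {f : E → G} {H : E → F}
    (h0 : (0 : E) ∉ tsupport f) (hH : ∀ x, f x = 0 → H x = 0)
    (hc : ∀ x, x ≠ 0 → ContinuousAt H x) : Continuous H := by
  rw [continuous_iff_continuousAt]
  intro x
  by_cases hx : x = 0
  · subst hx
    have h1 : H =ᶠ[nhds 0] 0 := (notMem_tsupport_iff_eventuallyEq.1 h0).mono fun y hy => hH y hy
    exact continuousAt_const.congr h1.symm
  · exact hc x hx

/-- Integrability of weighted densities vanishing with `f`, `f` supported away from the origin. -/
theorem integrable_of_continuousAt_of_notMem_tsupport {d : ℕ} {G : Type*} [NormedAddCommGroup G]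
    {f : EuclideanSpace ℝ (Fin d) → G} {H : EuclideanSpace ℝ (Fin d) → ℝ}
    (hs : HasCompactSupport f) (h0 : 0 ∉ tsupport f) (hH : ∀ x, f x = 0 → H x = 0)
    (hc : ∀ x, x ≠ 0 → ContinuousAt H x) : Integrable H :=
  (continuous_of_continuousAt_of_notMem_tsupport h0 hH hc).integrable_of_hasCompactSupport
    (hs.mono fun x hx => fun h => hx (hH x h))

theorem integral_hardy_identity {d : ℕ} {f : EuclideanSpace ℝ (Fin d) → ℂ}
    (hf : ContDiff ℝ 1 f) (hs : HasCompactSupport f) (h0 : 0 ∉ tsupport f) :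
    ∫ x, ((d - 2 : ℝ) * (‖f x‖ ^ 2 / ‖x‖ ^ 2) +
      2 * (inner ℝ (f x) (fderiv ℝ f x x) / ‖x‖ ^ 2)) = 0 := by
  have hc := hf.continuous
  have hc' := hf.continuous_fderiv one_ne_zero
  have hψ : ContDiff ℝ 1 fun x => (‖x‖ ^ 2)⁻¹ * ‖f x‖ ^ 2 := by
    rw [contDiff_iff_contDiffAt]
    intro x
    by_cases hx : x = 0
    · subst hx
      have h1 : (fun x => (‖x‖ ^ 2)⁻¹ * ‖f x‖ ^ 2) =ᶠ[nhds 0] 0 :=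
        (notMem_tsupport_iff_eventuallyEq.1 h0).mono fun y hy => by simp [hy]
      exact contDiffAt_const.congr_of_eventuallyEq h1
    · exact ((contDiff_norm_sq ℝ).contDiffAt.inv (by simpa using hx)).mul
        (hf.norm_sq ℝ).contDiffAt
  have hψs : HasCompactSupport fun x => (‖x‖ ^ 2)⁻¹ * ‖f x‖ ^ 2 :=
    hs.mono fun x hx => fun h => hx (by simp [h])
  have key := integral_fderiv_apply_self hψ hψs
  have hfd : ∀ x, fderiv ℝ (fun x => (‖x‖ ^ 2)⁻¹ * ‖f x‖ ^ 2) x x =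
      -2 * (‖f x‖ ^ 2 / ‖x‖ ^ 2) + 2 * (inner ℝ (f x) (fderiv ℝ f x x) / ‖x‖ ^ 2) := by
    intro x
    by_cases hx : x = 0
    · simp [hx]
    have hx2 : ‖x‖ ^ 2 ≠ 0 := by simpa using hx
    have h1 := ((hasDerivAt_inv hx2).comp_hasFDerivAt x
      (hasStrictFDerivAt_norm_sq x).hasFDerivAt).mul
      ((hf.differentiable one_ne_zero x).hasFDerivAt.norm_sq)
    have h2 := congrArg (fun L => L x) h1.fderiv
    simp only [Function.comp_apply, add_apply, smul_apply, ContinuousLinearMap.comp_apply,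
      innerSL_apply_apply, smul_eq_mul, nsmul_eq_mul, real_inner_self_eq_norm_sq,
      Nat.cast_ofNat] at h2
    refine h2.trans ?_
    field_simp
    ring
  simp only [hfd] at key
  have i1 : Integrable fun x => ‖f x‖ ^ 2 / ‖x‖ ^ 2 :=
    integrable_of_continuousAt_of_notMem_tsupport hs h0 (fun x hx => by simp [hx])
      fun x hx => by fun_prop (disch := simpa using hx)
  have i2 : Integrable fun x => inner ℝ (f x) (fderiv ℝ f x x) / ‖x‖ ^ 2 :=
    integrable_of_continuousAt_of_notMem_tsupport hs h0 (fun x hx => by simp [hx])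
      fun x hx => by fun_prop (disch := simpa using hx)
  rw [integral_add (i1.const_mul _) (i2.const_mul _), integral_const_mul, integral_const_mul] at *
  have e : ∫ x, (‖x‖ ^ 2)⁻¹ * ‖f x‖ ^ 2 = ∫ x, ‖f x‖ ^ 2 / ‖x‖ ^ 2 := by
    congr 1; ext x; ring
  rw [e] at key
  linarith

/-- The radial power map `y ↦ |y|^(γ-1) y`. -/
noncomputable def radialPow {E : Type*} [NormedAddCommGroup E] [NormedSpace ℝ E] (γ : ℝ) (y : E) :
    E :=
  ‖y‖ ^ (γ - 1) • y

section RadialPow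

variable {E : Type*} [NormedAddCommGroup E] [InnerProductSpace ℝ E]

theorem norm_radialPow {γ : ℝ} (hγ : γ ≠ 0) (y : E) : ‖radialPow γ y‖ = ‖y‖ ^ γ := by
  rw [radialPow, norm_smul, Real.norm_of_nonneg (by positivity),
    ← Real.rpow_add_one' (norm_nonneg y) (by simpa using hγ), sub_add_cancel]

theorem radialPow_ne_zero {γ : ℝ} {y : E} (hy : y ≠ 0) : radialPow γ y ≠ 0 :=
  smul_ne_zero (Real.rpow_pos_of_pos (norm_pos_iff.2 hy) _).ne' hy

theorem radialPow_radialPow {γ β : ℝ} (h : γ * β = 1) {y : E} (hy : y ≠ 0) :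
    radialPow β (radialPow γ y) = y := by
  have hγ : γ ≠ 0 := left_ne_zero_of_mul_eq_one h
  have hy0 := norm_pos_iff.2 hy
  rw [radialPow, norm_radialPow hγ, radialPow, smul_smul, ← Real.rpow_mul hy0.le,
    ← Real.rpow_add hy0, show γ * (β - 1) + (γ - 1) = 0 by linarith, Real.rpow_zero, one_smul]

theorem hasFDerivAt_norm_rpow_of_ne_zero {y : E} (hy : y ≠ 0) (s : ℝ) :
    HasFDerivAt (fun y : E => ‖y‖ ^ s) ((s * ‖y‖ ^ s / ‖y‖ ^ 2) • innerSL ℝ y) y := by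
  have hy0 := norm_pos_iff.2 hy
  have h1 := (hasStrictFDerivAt_norm_sq y).hasFDerivAt.rpow_const (p := s / 2)
    (Or.inl (by positivity))
  have e : ∀ z : E, (‖z‖ ^ 2) ^ (s / 2) = ‖z‖ ^ s := fun z => by
    rw [← Real.rpow_natCast, ← Real.rpow_mul (norm_nonneg z)]
    congr 1; push_cast; ring
  simp only [e] at h1
  refine h1.congr_fderiv ?_
  ext z
  rw [Real.rpow_sub_one (by positivity), e]
  simp
  ring

/-- The derivative of `radialPow γ` at `y ≠ 0`. -/
noncomputable def radialPowDeriv (γ : ℝ) (y : E) : E →L[ℝ] E :=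
  ‖y‖ ^ (γ - 1) • (ContinuousLinearMap.id ℝ E + (innerSL ℝ y).smulRight (((γ - 1) / ‖y‖ ^ 2) • y))

theorem hasFDerivAt_radialPow {γ : ℝ} {y : E} (hy : y ≠ 0) :
    HasFDerivAt (radialPow γ) (radialPowDeriv γ y) y := by
  refine ((hasFDerivAt_norm_rpow_of_ne_zero hy (γ - 1)).smul (hasFDerivAt_id y)).congr_fderiv ?_
  ext z
  simp only [radialPowDeriv, add_apply, smul_apply, ContinuousLinearMap.smulRight_apply,
    innerSL_apply_apply, ContinuousLinearMap.id_apply, id, smul_add, smul_smul, smul_eq_mul]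
  congr 2
  ring

theorem det_radialPowDeriv [FiniteDimensional ℝ E] {γ : ℝ} {y : E} (hy : y ≠ 0) :
    (radialPowDeriv γ y).det = γ * ‖y‖ ^ (Module.finrank ℝ E * (γ - 1)) := by
  have hy0 := norm_pos_iff.2 hy
  have e : ((radialPowDeriv γ y : E →L[ℝ] E) : E →ₗ[ℝ] E) = ‖y‖ ^ (γ - 1) •
      LinearMap.transvection ((innerSL ℝ y : E →L[ℝ] ℝ) : E →ₗ[ℝ] ℝ) (((γ - 1) / ‖y‖ ^ 2) • y) := by
    ext z
    simp [radialPowDeriv, LinearMap.transvection]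
  rw [ContinuousLinearMap.det, e, LinearMap.det_smul, LinearMap.transvection.det,
    ← Real.rpow_natCast, ← Real.rpow_mul hy0.le]
  simp
  field_simp
  ring

theorem image_radialPow_compl_zero {γ : ℝ} (hγ : γ ≠ 0) :
    radialPow γ '' ({0}ᶜ : Set E) = {0}ᶜ := by
  refine Set.Subset.antisymm ?_ ?_
  · rintro _ ⟨y, hy, rfl⟩
    exact radialPow_ne_zero hy
  · intro x hx
    exact ⟨radialPow γ⁻¹ x, radialPow_ne_zero hx,
      radialPow_radialPow (inv_mul_cancel₀ hγ) hx⟩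

theorem integral_comp_radialPow [FiniteDimensional ℝ E] [MeasurableSpace E] [BorelSpace E]
    [Nontrivial E] {γ : ℝ} (hγ : 0 < γ) (φ : E → ℝ) :
    ∫ y, ‖y‖ ^ (Module.finrank ℝ E * (γ - 1)) * φ (radialPow γ y) = γ⁻¹ * ∫ x, φ x := by
  have hinj : Set.InjOn (radialPow γ) ({0}ᶜ : Set E) := fun y hy z hz h => by
    rw [← radialPow_radialPow (mul_inv_cancel₀ hγ.ne') hy, h,
      radialPow_radialPow (mul_inv_cancel₀ hγ.ne') hz]
  have key := integral_image_eq_integral_abs_det_fderiv_smul (volume : Measure E)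
    (measurableSet_singleton (0 : E)).compl
    (fun y hy => (hasFDerivAt_radialPow (γ := γ) hy).hasFDerivWithinAt) hinj φ
  have hdet : ∫ y in ({0}ᶜ : Set E), |(radialPowDeriv γ y).det| • φ (radialPow γ y) =
      ∫ y in ({0}ᶜ : Set E),
        γ * (‖y‖ ^ (Module.finrank ℝ E * (γ - 1)) * φ (radialPow γ y)) := by
    refine setIntegral_congr_fun (measurableSet_singleton (0 : E)).compl fun y hy => ?_
    simp only [det_radialPowDeriv hy, smul_eq_mul]
    rw [abs_of_nonneg (by positivity), mul_assoc]
  rw [image_radialPow_compl_zero hγ.ne', hdet, restrict_compl_singleton, integral_const_mul] at key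
  rw [key]
  field_simp

end RadialPow

theorem sum_norm_sq_add_smul {d : ℕ} (L : EuclideanSpace ℝ (Fin d) →L[ℝ] ℂ)
    (x : EuclideanSpace ℝ (Fin d)) (u : ℂ) :
    ∑ k, ‖L (EuclideanSpace.single k 1) + x k • u‖ ^ 2 =
      ∑ k, ‖L (EuclideanSpace.single k 1)‖ ^ 2 + 2 * inner ℝ (L x) u + ‖x‖ ^ 2 * ‖u‖ ^ 2 := by
  rw [apply_eq_sum_single L x, sum_inner, EuclideanSpace.norm_sq_eq, Finset.mul_sum,
    Finset.sum_mul, ← Finset.sum_add_distrib, ← Finset.sum_add_distrib]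
  refine Finset.sum_congr rfl fun k _ => ?_
  rw [norm_add_sq_real, real_inner_smul_left, real_inner_smul_right, norm_smul, mul_pow]

theorem norm_sq_apply_le {d : ℕ} (L : EuclideanSpace ℝ (Fin d) →L[ℝ] ℂ)
    (x : EuclideanSpace ℝ (Fin d)) :
    ‖L x‖ ^ 2 ≤ ‖x‖ ^ 2 * ∑ k, ‖L (EuclideanSpace.single k 1)‖ ^ 2 := by
  by_cases hx : x = 0
  · simp [hx]
  have hx0 := norm_pos_iff.2 hx
  have h1 := sum_norm_sq_add_smul L x ((-(1 / ‖x‖ ^ 2)) • L x)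
  have h2 : 0 ≤ ∑ k, ‖L (EuclideanSpace.single k 1) + x k • (-(1 / ‖x‖ ^ 2)) • L x‖ ^ 2 := by
    positivity
  rw [h1, real_inner_smul_right, real_inner_self_eq_norm_sq, norm_smul, mul_pow, norm_neg,
    Real.norm_of_nonneg (by positivity)] at h2
  have h3 : ‖x‖ ^ 2 * ((1 / ‖x‖ ^ 2) ^ 2 * ‖L x‖ ^ 2) = ‖L x‖ ^ 2 / ‖x‖ ^ 2 := by
    field_simp
  rw [h3] at h2
  have h4 : ‖L x‖ ^ 2 / ‖x‖ ^ 2 ≤ ∑ k, ‖L (EuclideanSpace.single k 1)‖ ^ 2 := by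
    have : 2 * (-(1 / ‖x‖ ^ 2) * ‖L x‖ ^ 2) = -2 * (‖L x‖ ^ 2 / ‖x‖ ^ 2) := by ring
    linarith
  rwa [div_le_iff₀ (by positivity), mul_comm] at h4

/-- The density of the kinetic energy after the radial change of variables. -/
noncomputable def radialKineticDensity {d : ℕ} (γ α : ℝ) (f : EuclideanSpace ℝ (Fin d) → ℂ)
    (x : EuclideanSpace ℝ (Fin d)) : ℝ :=
  ∑ k, ‖fderiv ℝ f x (EuclideanSpace.single k 1)‖ ^ 2 +
    (γ ^ 2 - 1) * (‖fderiv ℝ f x x‖ ^ 2 / ‖x‖ ^ 2) +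
    2 * α * γ * (γ - 1) * (inner ℝ (f x) (fderiv ℝ f x x) / ‖x‖ ^ 2) +
    α ^ 2 * (γ - 1) ^ 2 * (‖f x‖ ^ 2 / ‖x‖ ^ 2)

theorem sum_norm_sq_fderiv_radial {d : ℕ} {f : EuclideanSpace ℝ (Fin d) → ℂ}
    (hf : Differentiable ℝ f) {γ α : ℝ} (hα : 2 * α = d - 2)
    {y : EuclideanSpace ℝ (Fin d)} (hy : y ≠ 0) :
    ∑ k, ‖fderiv ℝ (fun y => ‖y‖ ^ (α * (γ - 1)) • f (radialPow γ y)) y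
        (EuclideanSpace.single k 1)‖ ^ 2 =
      ‖y‖ ^ ((d : ℝ) * (γ - 1)) * radialKineticDensity γ α f (radialPow γ y) := by
  have hy0 := norm_pos_iff.2 hy
  have hD := (hasFDerivAt_norm_rpow_of_ne_zero hy (α * (γ - 1))).smul
    ((hf (radialPow γ y)).hasFDerivAt.comp y (hasFDerivAt_radialPow (γ := γ) hy))
  have hfd : fderiv ℝ (fun y => ‖y‖ ^ (α * (γ - 1)) • f (radialPow γ y)) y = _ := hD.fderiv
  rw [hfd]
  clear hfd hD
  set t := ‖y‖ ^ (γ - 1) with ht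
  have ht0 : 0 < t := Real.rpow_pos_of_pos hy0 _
  set c := ‖y‖ ^ (α * (γ - 1)) with hc
  set X := radialPow γ y with hX
  have hXy : X = t • y := rfl
  set L := fderiv ℝ f X with hL
  have hLX : L X = t • L y := by rw [hXy, map_smul]
  have hk : ∀ k, (c • (L ∘SL radialPowDeriv γ y) + ((α * (γ - 1) * c / ‖y‖ ^ 2) •
      innerSL ℝ y).smulRight ((f ∘ radialPow γ) y)) (EuclideanSpace.single k 1) =
      (c * t) • (L (EuclideanSpace.single k 1) +
        y k • (((γ - 1) / (t * ‖y‖ ^ 2)) • (L X + α • f X))) := by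
    intro k
    simp only [radialPowDeriv, add_apply, smul_apply, ContinuousLinearMap.smulRight_apply,
      innerSL_apply_apply, ContinuousLinearMap.id_apply, ContinuousLinearMap.comp_apply,
      smul_add, smul_smul, smul_eq_mul, EuclideanSpace.inner_single_right, map_add, map_smul, hLX,
      Function.comp_apply, ← hX, ← ht, add_assoc]
    simp only [one_mul, conj_trivial]
    congr 3
    · field_simp
    · field_simp
  simp only [hk, norm_smul (c * t), mul_pow ‖c * t‖]
  rw [← Finset.mul_sum, sum_norm_sq_add_smul]
  have hct : ‖c * t‖ ^ 2 = ‖y‖ ^ ((d : ℝ) * (γ - 1)) := by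
    rw [Real.norm_of_nonneg (by positivity), hc, ht, ← Real.rpow_add hy0, ← Real.rpow_natCast,
      ← Real.rpow_mul hy0.le]
    congr 1
    push_cast
    linear_combination (γ - 1) * hα
  have hnX : ‖X‖ = t * ‖y‖ := by rw [hXy, norm_smul, Real.norm_of_nonneg ht0.le]
  rw [hct, radialKineticDensity, ← hL, hnX]
  congr 1
  have hLy : L y = t⁻¹ • L X := by rw [hLX, smul_smul, inv_mul_cancel₀ ht0.ne', one_smul]
  rw [hLy, real_inner_smul_left, real_inner_smul_right, norm_smul, mul_pow, Real.norm_eq_abs,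
    sq_abs, norm_add_sq_real, inner_add_right, real_inner_smul_right,
    norm_smul, mul_pow, Real.norm_eq_abs, sq_abs, real_inner_self_eq_norm_sq,
    real_inner_comm (L X) (f X)]
  field_simp
  ring

theorem contDiff_norm_rpow_smul_comp_radialPow {d : ℕ} {f : EuclideanSpace ℝ (Fin d) → ℂ}
    (hf : ContDiff ℝ 1 f) (h0 : 0 ∉ tsupport f) {γ : ℝ} (hγ : 0 < γ) (s : ℝ) :
    ContDiff ℝ 1 fun y => ‖y‖ ^ s • f (radialPow γ y) := by
  rw [contDiff_iff_contDiffAt]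
  intro y
  by_cases hy : y = 0
  · subst hy
    have hΦ : Filter.Tendsto (radialPow γ) (nhds (0 : EuclideanSpace ℝ (Fin d))) (nhds 0) := by
      rw [tendsto_zero_iff_norm_tendsto_zero]
      simp only [norm_radialPow hγ.ne']
      have : Continuous fun y : EuclideanSpace ℝ (Fin d) => ‖y‖ ^ γ :=
        continuous_norm.rpow_const fun _ => Or.inr hγ.le
      simpa [Real.zero_rpow hγ.ne'] using this.tendsto 0
    have h1 : (fun y => ‖y‖ ^ s • f (radialPow γ y)) =ᶠ[nhds 0] 0 :=
      (hΦ.eventually (notMem_tsupport_iff_eventuallyEq.1 h0)).mono fun y hy => by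
        simp only [hy, Pi.zero_apply, smul_zero]
    exact contDiffAt_const.congr_of_eventuallyEq h1
  · have hn : ∀ r : ℝ, ContDiffAt ℝ 1 (fun y : EuclideanSpace ℝ (Fin d) => ‖y‖ ^ r) y := fun r =>
      (contDiffAt_norm ℝ hy).rpow_const_of_ne (norm_pos_iff.2 hy).ne'
    exact (hn s).smul (hf.contDiffAt.comp y ((hn _).smul contDiffAt_id))

theorem hasCompactSupport_norm_rpow_smul_comp_radialPow {d : ℕ}
    {f : EuclideanSpace ℝ (Fin d) → ℂ} (hs : HasCompactSupport f) {γ : ℝ} (hγ : 0 < γ) (s : ℝ) :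
    HasCompactSupport fun y => ‖y‖ ^ s • f (radialPow γ y) := by
  obtain ⟨R, hR⟩ := hs.isCompact.isBounded.subset_closedBall 0
  refine HasCompactSupport.intro
    (isCompact_closedBall (0 : EuclideanSpace ℝ (Fin d)) ((max R 0) ^ γ⁻¹)) fun y hy => ?_
  rw [mem_closedBall_zero_iff, not_le] at hy
  have h1 : f (radialPow γ y) = 0 := by
    by_contra hne
    have h2 := hR (subset_tsupport f hne)
    rw [mem_closedBall_zero_iff, norm_radialPow hγ.ne'] at h2
    have h3 := Real.rpow_lt_rpow (by positivity) hy hγ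
    rw [← Real.rpow_mul (by positivity), inv_mul_cancel₀ hγ.ne', Real.rpow_one] at h3
    linarith [le_max_left R 0]
  rw [h1, smul_zero]

theorem integrable_sum_norm_sq_fderiv {d : ℕ} {f : EuclideanSpace ℝ (Fin d) → ℂ}
    (hf : ContDiff ℝ 1 f) (hs : HasCompactSupport f) :
    Integrable fun x => ∑ k, ‖fderiv ℝ f x (EuclideanSpace.single k 1)‖ ^ 2 := by
  have hc := hf.continuous_fderiv one_ne_zero
  refine Continuous.integrable_of_hasCompactSupport (by fun_prop)
    ((hs.fderiv (𝕜 := ℝ)).comp_left (g := fun T : EuclideanSpace ℝ (Fin d) →L[ℝ] ℂ =>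
      ∑ k, ‖T (EuclideanSpace.single k 1)‖ ^ 2) ?_)
  simp

/-- The sharp Sobolev inequality for the Hardy operator with attractive coupling
`(γ⁻² - 1) ((d-2)/2)²`, `γ ≥ 1`. -/
theorem sharp_hardy_sobolev {d : ℕ} (hd : 3 ≤ d) {γ : ℝ} (hγ : 1 ≤ γ)
    {f : EuclideanSpace ℝ (Fin d) → ℂ} (hf : ContDiff ℝ 1 f) (hs : HasCompactSupport f)
    (h0 : 0 ∉ tsupport f) {I : ℝ}
    (hI : I = ∫ x : EuclideanSpace ℝ (Fin d), ((1 + ‖x‖ ^ 2) ^ d)⁻¹) {Q : ℝ}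
    (hle_Q : ∫ x, (∑ k, ‖fderiv ℝ f x (EuclideanSpace.single k 1)‖ ^ 2 +
        ((γ⁻¹ ^ 2 - 1) * ((d - 2) / 2 : ℝ) ^ 2) / ‖x‖ ^ 2 * ‖f x‖ ^ 2) ≤ Q) :
    ∫ x, ‖f x‖ ^ (2 * (d : ℝ) / (d - 2)) ≤
      γ * (I * (γ * Q / (d * (d - 2) * I)) ^ ((d : ℝ) / (d - 2))) := by
  have hγ0 : 0 < γ := by linarith
  have hd3 : (3 : ℝ) ≤ d := by exact_mod_cast hd
  have hd2 : (0 : ℝ) < d - 2 := by linarith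
  have hI0 : 0 < I := hI ▸ integral_bubble_pos (by lia)
  have : Nontrivial (EuclideanSpace ℝ (Fin d)) := by
    have : Nonempty (Fin d) := ⟨⟨0, by lia⟩⟩
    infer_instance
  set α : ℝ := (d - 2) / 2 with hα
  have hα2 : 2 * α = d - 2 := by rw [hα]; ring
  have hvC := contDiff_norm_rpow_smul_comp_radialPow hf h0 hγ0 (α * (γ - 1))
  have hvs := hasCompactSupport_norm_rpow_smul_comp_radialPow hs hγ0 (α * (γ - 1))
  have hsob := sharp_sobolev hd hvC hvs hI
  have hcv := fun φ => integral_comp_radialPow (E := EuclideanSpace ℝ (Fin d)) hγ0 φ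
  rw [finrank_euclideanSpace_fin] at hcv
  have hS : ∫ y, ‖‖y‖ ^ (α * (γ - 1)) • f (radialPow γ y)‖ ^ (2 * (d : ℝ) / (d - 2)) =
      γ⁻¹ * ∫ x, ‖f x‖ ^ (2 * (d : ℝ) / (d - 2)) := by
    rw [← hcv]
    congr 1
    ext y
    rw [norm_smul, Real.norm_of_nonneg (by positivity), Real.mul_rpow (by positivity)
      (by positivity), ← Real.rpow_mul (norm_nonneg y)]
    congr 2
    rw [hα]
    field_simp
  have hG : ∫ y, ∑ k, ‖fderiv ℝ (fun y => ‖y‖ ^ (α * (γ - 1)) • f (radialPow γ y)) y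
      (EuclideanSpace.single k 1)‖ ^ 2 = γ⁻¹ * ∫ x, radialKineticDensity γ α f x := by
    rw [← hcv]
    refine integral_congr_ae ?_
    filter_upwards [Measure.ae_ne volume (0 : EuclideanSpace ℝ (Fin d))] with y hy
    exact sum_norm_sq_fderiv_radial (hf.differentiable one_ne_zero) hα2 hy
  have hc := hf.continuous
  have hc' := hf.continuous_fderiv one_ne_zero
  have hsd : HasCompactSupport (fderiv ℝ f) := hs.fderiv (𝕜 := ℝ)
  have i0 := integrable_sum_norm_sq_fderiv hf hs
  have i1 : Integrable fun x => ‖f x‖ ^ 2 / ‖x‖ ^ 2 :=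
    integrable_of_continuousAt_of_notMem_tsupport hs h0 (fun x hx => by simp [hx])
      fun x hx => by fun_prop (disch := simpa using hx)
  have i2 : Integrable fun x => inner ℝ (f x) (fderiv ℝ f x x) / ‖x‖ ^ 2 :=
    integrable_of_continuousAt_of_notMem_tsupport hs h0 (fun x hx => by simp [hx])
      fun x hx => by fun_prop (disch := simpa using hx)
  have i3 : Integrable fun x => ‖fderiv ℝ f x x‖ ^ 2 / ‖x‖ ^ 2 :=
    integrable_of_continuousAt_of_notMem_tsupport hsd (fun h => h0 (tsupport_fderiv_subset ℝ h))
      (fun x hx => by simp [hx]) fun x hx => by fun_prop (disch := simpa using hx)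
  have hhardy := integral_hardy_identity hf hs h0
  rw [integral_add (i1.const_mul _) (i2.const_mul _), integral_const_mul, integral_const_mul]
    at hhardy
  have hle : ∫ x, radialKineticDensity γ α f x ≤
      ∫ x, (γ ^ 2 * ∑ k, ‖fderiv ℝ f x (EuclideanSpace.single k 1)‖ ^ 2 +
        2 * α * γ * (γ - 1) * (inner ℝ (f x) (fderiv ℝ f x x) / ‖x‖ ^ 2) +
        α ^ 2 * (γ - 1) ^ 2 * (‖f x‖ ^ 2 / ‖x‖ ^ 2)) := by
    refine integral_mono ((((i0.add (i3.const_mul _)).add (i2.const_mul _))).add (i1.const_mul _))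
      (((i0.const_mul _).add (i2.const_mul _)).add (i1.const_mul _)) fun x => ?_
    have h1 : ‖fderiv ℝ f x x‖ ^ 2 / ‖x‖ ^ 2 ≤
        ∑ k, ‖fderiv ℝ f x (EuclideanSpace.single k 1)‖ ^ 2 := by
      refine div_le_of_le_mul₀ (by positivity) (by positivity) ?_
      rw [mul_comm]
      exact norm_sq_apply_le _ x
    have h2 := mul_le_mul_of_nonneg_left h1 (by nlinarith : 0 ≤ γ ^ 2 - 1)
    simp only [radialKineticDensity]
    linarith
  have hQ : ∫ x, (∑ k, ‖fderiv ℝ f x (EuclideanSpace.single k 1)‖ ^ 2 +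
      ((γ⁻¹ ^ 2 - 1) * α ^ 2) / ‖x‖ ^ 2 * ‖f x‖ ^ 2) =
      (∫ x, ∑ k, ‖fderiv ℝ f x (EuclideanSpace.single k 1)‖ ^ 2) +
      ((γ⁻¹ ^ 2 - 1) * α ^ 2) * ∫ x, ‖f x‖ ^ 2 / ‖x‖ ^ 2 := by
    rw [← integral_const_mul, ← integral_add i0 (i1.const_mul _)]
    congr 1
    ext x
    ring
  have i4 : Integrable fun x => γ ^ 2 * ∑ k, ‖fderiv ℝ f x (EuclideanSpace.single k 1)‖ ^ 2 +
        2 * α * γ * (γ - 1) * (inner ℝ (f x) (fderiv ℝ f x x) / ‖x‖ ^ 2) :=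
    (i0.const_mul _).add (i2.const_mul _)
  rw [integral_add i4 (i1.const_mul _), integral_add (i0.const_mul _) (i2.const_mul _),
    integral_const_mul, integral_const_mul, integral_const_mul] at hle
  rw [hS, hG] at hsob
  rw [hQ] at hle_Q
  rw [inv_mul_le_iff₀ hγ0] at hsob
  refine hsob.trans ?_
  have hD0 : 0 ≤ γ⁻¹ * ∫ x, radialKineticDensity γ α f x := by
    rw [← hG]
    exact integral_nonneg fun x => by positivity
  have hfin : γ⁻¹ * ∫ x, radialKineticDensity γ α f x ≤
      γ * ((∫ x, ∑ k, ‖fderiv ℝ f x (EuclideanSpace.single k 1)‖ ^ 2) +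
      ((γ⁻¹ ^ 2 - 1) * α ^ 2) * ∫ x, ‖f x‖ ^ 2 / ‖x‖ ^ 2) := by
    rw [inv_mul_le_iff₀ hγ0]
    refine hle.trans (le_of_eq ?_)
    rw [← hα2] at hhardy
    have e : γ * (γ * ((∫ x, ∑ k, ‖fderiv ℝ f x (EuclideanSpace.single k 1)‖ ^ 2) +
      ((γ⁻¹ ^ 2 - 1) * α ^ 2) * ∫ x, ‖f x‖ ^ 2 / ‖x‖ ^ 2)) =
      γ ^ 2 * (∫ x, ∑ k, ‖fderiv ℝ f x (EuclideanSpace.single k 1)‖ ^ 2) +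
      (1 - γ ^ 2) * α ^ 2 * ∫ x, ‖f x‖ ^ 2 / ‖x‖ ^ 2 := by
      field_simp
    rw [e]
    linear_combination α * γ * (γ - 1) * hhardy
  have hfin' := hfin.trans (mul_le_mul_of_nonneg_left hle_Q hγ0.le)
  gcongr

theorem sum_sq_fderiv_radial {d : ℕ} {W : EuclideanSpace ℝ (Fin d) → ℝ} {ω : ℝ → ℝ}
    (hW : ∀ x, W x = ω ‖x‖) {x : EuclideanSpace ℝ (Fin d)} (hx : x ≠ 0) {ω' : ℝ}
    (hω : HasDerivAt ω ω' ‖x‖) :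
    ∑ k, fderiv ℝ W x (EuclideanSpace.single k 1) ^ 2 = ω' ^ 2 := by
  have hx0 := norm_pos_iff.2 hx
  have hn := hasFDerivAt_norm_rpow_of_ne_zero hx 1
  simp only [Real.rpow_one, one_mul] at hn
  have h1 : HasFDerivAt W _ x := (hω.comp_hasFDerivAt x hn).congr_of_eventuallyEq
    (Filter.Eventually.of_forall hW)
  rw [h1.fderiv]
  simp only [smul_apply, innerSL_apply_apply, smul_eq_mul, EuclideanSpace.inner_single_right,
    mul_pow, one_mul, conj_trivial]
  rw [← Finset.mul_sum, ← Finset.mul_sum, ← EuclideanSpace.real_norm_sq_eq]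
  field_simp

/-- The profile `r^β / (1 + r^{2β})`. -/
noncomputable def solitonProfile (β r : ℝ) : ℝ := r ^ β / (1 + r ^ (2 * β))

theorem rpow_two_mul' {r : ℝ} (hr : 0 ≤ r) (β : ℝ) : r ^ (2 * β) = (r ^ β) ^ 2 := by
  rw [mul_comm, Real.rpow_mul hr, Real.rpow_two]

theorem integrableOn_solitonProfile_div {β : ℝ} (hβ : 0 < β) :
    IntegrableOn (fun r => solitonProfile β r / r) (Set.Ioi 0) := by
  have hd : ∀ r ∈ Set.Ioi (0 : ℝ), HasDerivAt (fun r : ℝ => β⁻¹ * Real.arctan (r ^ β))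
      (solitonProfile β r / r) r := by
    intro r hr
    have hr0 : 0 < r := hr
    refine ((Real.hasDerivAt_rpow_const (Or.inl hr0.ne')).arctan.const_mul β⁻¹).congr_deriv ?_
    rw [Real.rpow_sub_one hr0.ne', solitonProfile, rpow_two_mul' hr0.le]
    field_simp
  have hc : Continuous fun r : ℝ => β⁻¹ * Real.arctan (r ^ β) :=
    continuous_const.mul (Real.continuous_arctan.comp
      (continuous_id.rpow_const fun _ => Or.inr hβ.le))
  refine integrableOn_Ioi_deriv_of_nonneg hc.continuousWithinAt hd (fun r hr => ?_)
    (l := β⁻¹ * (Real.pi / 2)) ?_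
  · have hr0 : 0 < r := hr
    rw [solitonProfile]
    positivity
  · exact ((Real.tendsto_arctan_atTop.mono_right nhdsWithin_le_nhds).comp
      (tendsto_rpow_atTop hβ)).const_mul _

theorem solitonProfile_nonneg (β : ℝ) {r : ℝ} (hr : 0 ≤ r) : 0 ≤ solitonProfile β r := by
  rw [solitonProfile]; positivity

theorem solitonProfile_le_one (β : ℝ) {r : ℝ} (hr : 0 ≤ r) : solitonProfile β r ≤ 1 := by
  rw [solitonProfile, rpow_two_mul' hr, div_le_one (by positivity)]
  nlinarith [sq_nonneg (r ^ β - 1), Real.rpow_nonneg hr β]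

/-- Integrability of the bounded multiples of the radial densities of the soliton. -/
theorem integrableOn_solitonProfile_pow_mul {β : ℝ} (hβ : 0 < β) {k : ℕ} (hk : 1 ≤ k)
    {B : ℝ → ℝ} (hB : Measurable B) {C : ℝ} (hC : ∀ r, 0 < r → |B r| ≤ C) :
    IntegrableOn (fun r => solitonProfile β r ^ k / r * B r) (Set.Ioi 0) := by
  have hm : Measurable (solitonProfile β) := by unfold solitonProfile; fun_prop
  refine ((integrableOn_solitonProfile_div hβ).mul_const C).mono' (by fun_prop) ?_
  filter_upwards [ae_restrict_mem measurableSet_Ioi] with r hr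
  have hr0 : 0 < r := hr
  have hz0 := solitonProfile_nonneg β hr0.le
  have hz1 := solitonProfile_le_one β hr0.le
  rw [norm_mul, Real.norm_of_nonneg (by positivity), Real.norm_eq_abs]
  have : solitonProfile β r ^ k ≤ solitonProfile β r := pow_le_of_le_one hz0 hz1 (by lia)
  have hC' := hC r hr0
  gcongr

/-- The weight `r^{2β} / (1 + r^{2β})`. -/
noncomputable def solitonWeight (β r : ℝ) : ℝ := r ^ (2 * β) / (1 + r ^ (2 * β))

theorem solitonWeight_nonneg (β : ℝ) {r : ℝ} (hr : 0 ≤ r) : 0 ≤ solitonWeight β r := by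
  rw [solitonWeight]; positivity

theorem solitonWeight_le_one (β : ℝ) {r : ℝ} (hr : 0 ≤ r) : solitonWeight β r ≤ 1 := by
  have : 0 ≤ r ^ (2 * β) := by positivity
  rw [solitonWeight, div_le_one (by positivity)]
  linarith

theorem solitonWeight_mul_one_sub (β : ℝ) {r : ℝ} (hr : 0 ≤ r) :
    solitonWeight β r * (1 - solitonWeight β r) = solitonProfile β r ^ 2 := by
  have : 0 ≤ r ^ β := by positivity
  rw [solitonWeight, solitonProfile, rpow_two_mul' hr]
  field_simp
  ring

theorem hasDerivAt_solitonProfile (β : ℝ) {r : ℝ} (hr : 0 < r) :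
    HasDerivAt (solitonProfile β)
      (solitonProfile β r * (β * (1 - 2 * solitonWeight β r)) / r) r := by
  have h2 := Real.hasDerivAt_rpow_const (p := 2 * β) (Or.inl hr.ne')
  have h1 := Real.hasDerivAt_rpow_const (p := β) (Or.inl hr.ne')
  have h : HasDerivAt (solitonProfile β) _ r := h1.div (h2.const_add 1) (by positivity)
  refine h.congr_deriv ?_
  rw [Real.rpow_sub_one hr.ne', Real.rpow_sub_one hr.ne', solitonProfile, solitonWeight,
    rpow_two_mul' hr.le]
  have : 0 < r ^ β := by positivity
  field_simp

theorem hasDerivAt_solitonWeight (β : ℝ) {r : ℝ} (hr : 0 < r) :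
    HasDerivAt (solitonWeight β) (2 * β * solitonProfile β r ^ 2 / r) r := by
  have h2 := Real.hasDerivAt_rpow_const (p := 2 * β) (Or.inl hr.ne')
  have h : HasDerivAt (solitonWeight β) _ r := h2.div (h2.const_add 1) (by positivity)
  refine h.congr_deriv ?_
  rw [Real.rpow_sub_one hr.ne', solitonProfile, rpow_two_mul' hr.le]
  have : 0 < r ^ β := by positivity
  field_simp
  ring

theorem continuousAt_zero_solitonProfile {β : ℝ} (hβ : 0 < β) :
    ContinuousAt (solitonProfile β) 0 := by
  have h1 : Continuous fun r : ℝ => r ^ β := continuous_id.rpow_const fun _ => Or.inr hβ.le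
  have h2 : Continuous fun r : ℝ => r ^ (2 * β) :=
    continuous_id.rpow_const fun _ => Or.inr (by positivity)
  exact h1.continuousAt.div (h2.continuousAt.const_add 1) (by simp [hβ.ne'])

theorem continuousAt_zero_solitonWeight {β : ℝ} (hβ : 0 < β) :
    ContinuousAt (solitonWeight β) 0 := by
  have h2 : Continuous fun r : ℝ => r ^ (2 * β) :=
    continuous_id.rpow_const fun _ => Or.inr (by positivity)
  exact h2.continuousAt.div (h2.continuousAt.const_add 1) (by simp [hβ.ne'])

theorem solitonProfile_zero {β : ℝ} (hβ : 0 < β) : solitonProfile β 0 = 0 := by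
  simp [solitonProfile, hβ.ne']

theorem tendsto_solitonProfile_atTop {β : ℝ} (hβ : 0 < β) :
    Filter.Tendsto (solitonProfile β) Filter.atTop (nhds 0) := by
  refine squeeze_zero' (Filter.eventually_atTop.2 ⟨0, fun r hr => solitonProfile_nonneg β hr⟩)
    ?_ (tendsto_rpow_neg_atTop hβ)
  filter_upwards [Filter.eventually_gt_atTop 0] with r hr
  have : 0 < r ^ β := by positivity
  rw [solitonProfile, rpow_two_mul' hr.le, Real.rpow_neg hr.le, div_le_iff₀ (by positivity)]
  have : (r ^ β)⁻¹ * (1 + (r ^ β) ^ 2) = (r ^ β)⁻¹ + r ^ β := by field_simp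
  rw [this]
  have : 0 < (r ^ β)⁻¹ := by positivity
  linarith

/-- The radial virial identity of the soliton. -/
theorem integral_soliton_virial {β : ℝ} (hβ : 0 < β) {n : ℕ} (hn : 1 ≤ n) {α : ℝ}
    (hα : (n : ℝ) = 2 * α) :
    ∫ r in Set.Ioi 0, solitonProfile β r ^ n / r *
        (α ^ 2 * ((β - 1 - 2 * β * solitonWeight β r) ^ 2 + (β ^ 2 - 1))) =
      ∫ r in Set.Ioi 0, solitonProfile β r ^ n / r *
        ((n + 2) * n * β ^ 2 * solitonProfile β r ^ 2) := by
  have hα0 : 0 ≤ α := by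
    have : (0 : ℝ) ≤ n := by positivity
    linarith
  have hmz : Measurable (solitonProfile β) := by unfold solitonProfile; fun_prop
  have hmt : Measurable (solitonWeight β) := by unfold solitonWeight; fun_prop
  have hB : ∀ r, 0 < r → |β - 1 - 2 * β * solitonWeight β r| ≤ 3 * β + 1 := by
    intro r hr
    have h0 := solitonWeight_nonneg β hr.le
    have h1 := solitonWeight_le_one β hr.le
    rw [abs_le]
    constructor <;> nlinarith
  have i1 : IntegrableOn (fun r => solitonProfile β r ^ n / r *
      (α ^ 2 * ((β - 1 - 2 * β * solitonWeight β r) ^ 2 + (β ^ 2 - 1)))) (Set.Ioi 0) := by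
    refine integrableOn_solitonProfile_pow_mul hβ hn (by fun_prop)
      (C := α ^ 2 * ((3 * β + 1) ^ 2 + (β ^ 2 + 1))) fun r hr => ?_
    have h1 := sq_le_sq' (by linarith [abs_le.1 (hB r hr)]) (abs_le.1 (hB r hr)).2
    rw [abs_mul, abs_of_nonneg (sq_nonneg α)]
    gcongr
    rw [abs_le]
    constructor <;> nlinarith [sq_nonneg (β - 1 - 2 * β * solitonWeight β r), sq_nonneg β]
  have i2 : IntegrableOn (fun r => solitonProfile β r ^ n / r *
      ((n + 2) * n * β ^ 2 * solitonProfile β r ^ 2)) (Set.Ioi 0) := by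
    refine integrableOn_solitonProfile_pow_mul hβ hn (by fun_prop)
      (C := (n + 2) * n * β ^ 2) fun r hr => ?_
    have h0 := solitonProfile_nonneg β hr.le
    have h1 := solitonProfile_le_one β hr.le
    rw [abs_of_nonneg (by positivity)]
    exact mul_le_of_le_one_right (by positivity) (pow_le_one₀ h0 h1)
  rw [← sub_eq_zero, ← integral_sub i1 i2]
  have hz : Filter.Tendsto (fun r => solitonProfile β r ^ n *
        (α * (β - 1 - 2 * β * solitonWeight β r))) Filter.atTop (nhds 0) := by
    have h0 : Filter.Tendsto (fun r => solitonProfile β r ^ n) Filter.atTop (nhds 0) := by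
      simpa [zero_pow (by lia : n ≠ 0)] using (tendsto_solitonProfile_atTop hβ).pow n
    refine h0.zero_mul_isBoundedUnder_le ?_
    refine Filter.isBoundedUnder_of_eventually_le (a := α * (3 * β + 1)) ?_
    filter_upwards [Filter.eventually_gt_atTop 0] with r hr
    rw [Function.comp_apply, norm_mul, Real.norm_of_nonneg hα0, Real.norm_eq_abs]
    exact mul_le_mul_of_nonneg_left (hB r hr) hα0
  have key := integral_Ioi_of_hasDerivAt_of_tendsto (a := (0 : ℝ)) (m := 0)
    (f := fun r => solitonProfile β r ^ n * (α * (β - 1 - 2 * β * solitonWeight β r)))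
    (((continuousAt_zero_solitonProfile hβ).pow n).mul (((continuousAt_const.sub
      ((continuousAt_zero_solitonWeight hβ).const_mul _))).const_mul α)).continuousWithinAt
    (fun r hr => ?_) (i1.sub i2) hz
  · simpa [solitonProfile_zero hβ, zero_pow (by lia : n ≠ 0)] using key
  · have hr0 : 0 < r := hr
    refine (((hasDerivAt_solitonProfile β hr0).pow n).mul
      ((((hasDerivAt_solitonWeight β hr0).const_mul (2 * β)).const_sub (β - 1)).const_mul
        α)).congr_deriv ?_
    have ht := solitonWeight_mul_one_sub β hr0.le
    obtain ⟨m, rfl⟩ : ∃ m, n = m + 1 := ⟨n - 1, by lia⟩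
    rw [hα]
    simp only [Pi.sub_apply, Pi.pow_apply, Nat.add_sub_cancel, pow_succ _ m]
    generalize solitonProfile β r = z at *
    generalize solitonWeight β r = t at *
    linear_combination (-(4 * α ^ 2 * β ^ 2 * (z ^ m * z) / r)) * ht

theorem rpow_sub_one_div_eq_solitonProfile_div (β : ℝ) {r : ℝ} (hr : 0 < r) :
    r ^ (β - 1) / (1 + r ^ (2 * β)) = solitonProfile β r / r := by
  rw [Real.rpow_sub_one hr.ne', solitonProfile, div_right_comm]

theorem solitonProfile_pos (β : ℝ) {r : ℝ} (hr : 0 < r) : 0 < solitonProfile β r := by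
  rw [solitonProfile]; positivity

theorem hasDerivAt_soliton (A α β : ℝ) {r : ℝ} (hr : 0 < r) :
    HasDerivAt (fun r => A * (r ^ (β - 1) / (1 + r ^ (2 * β))) ^ α)
      (A * (solitonProfile β r / r) ^ α * (α / r) * (β - 1 - 2 * β * solitonWeight β r)) r := by
  have hz := solitonProfile_pos β hr
  have h := (((hasDerivAt_solitonProfile β hr).div (hasDerivAt_id r) hr.ne').rpow_const
    (p := α) (Or.inl (div_pos hz hr).ne')).const_mul A
  refine (h.congr_of_eventuallyEq ?_).congr_deriv ?_
  · filter_upwards [lt_mem_nhds hr] with s hs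
    rw [rpow_sub_one_div_eq_solitonProfile_div β hs]
    rfl
  · rw [id, Pi.div_apply, id, Real.rpow_sub_one (div_pos hz hr).ne']
    field_simp
    ring

theorem integral_solitonProfile_pow_div {β : ℝ} (hβ : 0 < β) (k : ℕ) :
    ∫ r in Set.Ioi 0, solitonProfile β r ^ k / r =
      β⁻¹ * ∫ r in Set.Ioi 0, solitonProfile 1 r ^ k / r := by
  rw [← integral_comp_rpow_Ioi_of_pos (g := fun r => solitonProfile 1 r ^ k / r) hβ,
    ← integral_const_mul]
  refine setIntegral_congr_fun measurableSet_Ioi fun r hr => ?_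
  have hr0 : 0 < r := hr
  have : 0 < r ^ β := by positivity
  simp only [solitonProfile, smul_eq_mul, Real.rpow_sub_one hr0.ne', Real.rpow_one, mul_one,
    rpow_two_mul' hr0.le, Real.rpow_two]
  field_simp

/-- The value of the kinetic and potential energies of the ground state soliton. -/
theorem soliton_energies {d : ℕ} (hd : 3 ≤ d) {β : ℝ} (hβ : 0 < β)
    {W : EuclideanSpace ℝ (Fin d) → ℝ}
    (hW : ∀ x, W x = ((d : ℝ) * ((d : ℝ) - 2) * β ^ 2) ^ (((d : ℝ) - 2) / 4) *
        (‖x‖ ^ (β - 1) / (1 + ‖x‖ ^ (2 * β))) ^ (((d : ℝ) - 2) / 2))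
    {I : ℝ} (hI : I = ∫ x : EuclideanSpace ℝ (Fin d), ((1 + ‖x‖ ^ 2) ^ d)⁻¹) :
    ∫ x, W x ^ (2 * (d : ℝ) / (d - 2)) =
        ((d : ℝ) * ((d : ℝ) - 2) * β ^ 2) ^ ((d : ℝ) / 2) * (β⁻¹ * I) ∧
      ∫ x, ((∑ k, fderiv ℝ W x (EuclideanSpace.single k 1) ^ 2) +
        ((β ^ 2 - 1) * ((d - 2) / 2 : ℝ) ^ 2) / ‖x‖ ^ 2 * W x ^ 2) =
        ((d : ℝ) * ((d : ℝ) - 2) * β ^ 2) ^ ((d : ℝ) / 2) * (β⁻¹ * I) := by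
  obtain ⟨n, rfl⟩ : ∃ n, d = n + 2 := ⟨d - 2, by lia⟩
  have hn : 1 ≤ n := by lia
  have hn0 : (0 : ℝ) < n := by exact_mod_cast hn
  push_cast at hW ⊢
  simp only [add_sub_cancel_right] at hW ⊢
  set D : ℝ := ((n : ℝ) + 2) * n * β ^ 2 with hD
  have hD0 : 0 < D := by positivity
  set A : ℝ := D ^ ((n : ℝ) / 4) with hA
  have hA0 : 0 < A := by positivity
  set α : ℝ := (n : ℝ) / 2 with hα
  have hAp : A ^ (2 * ((n : ℝ) + 2) / n) = D ^ (((n : ℝ) + 2) / 2) := by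
    rw [hA, ← Real.rpow_mul hD0.le]
    congr 1
    field_simp
    norm_num
  have hA2 : A ^ 2 * D = D ^ (((n : ℝ) + 2) / 2) := by
    rw [hA, ← Real.rpow_natCast, ← Real.rpow_mul hD0.le, ← Real.rpow_add_one hD0.ne']
    congr 1
    push_cast
    ring
  have hpolar := fun φ : ℝ → ℝ =>
    integral_fun_norm_addHaar (volume : Measure (EuclideanSpace ℝ (Fin (n + 2)))) φ
  simp only [finrank_euclideanSpace_fin, nsmul_eq_mul, smul_eq_mul] at hpolar
  set c : ℝ := (volume : Measure (EuclideanSpace ℝ (Fin (n + 2)))).real (Metric.ball 0 1) with hc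
  have hIc : I = (n + 2 : ℕ) * (c * ∫ r in Set.Ioi 0, solitonProfile 1 r ^ (n + 2) / r) := by
    rw [hI, hpolar fun r => ((1 + r ^ 2) ^ (n + 2))⁻¹]
    congr 2
    refine setIntegral_congr_fun measurableSet_Ioi fun r hr => ?_
    have hr0 : 0 < r := hr
    simp only [solitonProfile, Real.rpow_one, mul_one, Real.rpow_two, Nat.add_succ_sub_one, div_pow]
    field_simp
    ring
  have hβI : ∀ C : ℝ, C * (β⁻¹ * I) =
      (n + 2 : ℕ) * (c * ∫ r in Set.Ioi 0, C * (solitonProfile β r ^ (n + 2) / r)) := by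
    intro C
    rw [integral_const_mul, hIc, integral_solitonProfile_pow_div hβ]
    ring
  have hpow : ∀ r, 0 < r → ((solitonProfile β r / r) ^ α) ^ 2 = (solitonProfile β r / r) ^ n := by
    intro r hr
    have := div_pos (solitonProfile_pos β hr) hr
    rw [← Real.rpow_natCast, ← Real.rpow_mul this.le, ← Real.rpow_natCast]
    congr 1
    push_cast
    rw [hα]
    ring
  constructor
  · simp only [hW]
    rw [hpolar fun r => (A * (r ^ (β - 1) / (1 + r ^ (2 * β))) ^ α) ^ (2 * ((n : ℝ) + 2) / n),
      hβI]
    congr 2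
    refine setIntegral_congr_fun measurableSet_Ioi fun r hr => ?_
    have hr0 : 0 < r := hr
    have hz := solitonProfile_pos β hr0
    have hzr := div_pos hz hr0
    rw [rpow_sub_one_div_eq_solitonProfile_div β hr0, Real.mul_rpow hA0.le (by positivity), hAp,
      ← Real.rpow_mul hzr.le, show α * (2 * ((n : ℝ) + 2) / n) = (n + 2 : ℕ) by
        rw [hα]; push_cast; field_simp, Real.rpow_natCast, div_pow, Nat.add_succ_sub_one]
    field_simp
    ring
  · obtain ⟨φ, hφ⟩ : ∃ φ : ℝ → ℝ, ∀ r, φ r =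
        (A * (solitonProfile β r / r) ^ α * (α / r) *
          (β - 1 - 2 * β * solitonWeight β r)) ^ 2 +
        ((β ^ 2 - 1) * α ^ 2) / r ^ 2 * (A * (solitonProfile β r / r) ^ α) ^ 2 :=
      ⟨_, fun _ => rfl⟩
    have h1 : ∫ x, ((∑ k, fderiv ℝ W x (EuclideanSpace.single k 1) ^ 2) +
        ((β ^ 2 - 1) * α ^ 2) / ‖x‖ ^ 2 * W x ^ 2) =
        ∫ x : EuclideanSpace ℝ (Fin (n + 2)), φ ‖x‖ := by
      refine integral_congr_ae ?_
      filter_upwards [Measure.ae_ne volume (0 : EuclideanSpace ℝ (Fin (n + 2)))] with x hx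
      have hx0 := norm_pos_iff.2 hx
      rw [sum_sq_fderiv_radial hW hx (hasDerivAt_soliton A α β hx0), hW,
        rpow_sub_one_div_eq_solitonProfile_div β hx0, hφ]
    rw [h1, hβI, hpolar φ]
    congr 2
    have h2 : ∫ r in Set.Ioi 0, D ^ (((n : ℝ) + 2) / 2) * (solitonProfile β r ^ (n + 2) / r) =
        A ^ 2 * ∫ r in Set.Ioi 0, solitonProfile β r ^ n / r *
          (α ^ 2 * ((β - 1 - 2 * β * solitonWeight β r) ^ 2 + (β ^ 2 - 1))) := by
      rw [integral_soliton_virial hβ hn (by rw [hα]; ring), ← hA2, ← integral_const_mul]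
      congr 1
      ext r
      rw [hD]
      ring
    rw [h2, ← integral_const_mul]
    refine setIntegral_congr_fun measurableSet_Ioi fun r hr => ?_
    have hr0 : 0 < r := hr
    simp only [hφ, mul_pow, hpow r hr0, div_pow, Nat.add_succ_sub_one]
    field_simp
    ring

/-- Negativity of the virial above the kinetic threshold: with
`W = W_{min(a,0)}`, `K = Q_{min(a,0)}(W)`, `E_W = E_{min(a,0)}(W)`, there exist
`δ₁, c > 0` (depending on `d, a, δ₀`) such that any smooth compactly supported
`f`, supported away from the origin, with `E_a(f) ≤ (1-δ₀)E_W` and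
`Q_a(f) ≥ K` satisfies: (1) `Q_a(f) ≥ (1+δ₁)K`; and
(2) `∫ |∇f|² + (a/|x|²)|f|² - |f|^{2d/(d-2)} ≤ -c < 0`. -/
theorem virial_negativity_above_threshold
    (d : ℕ) (hd : 3 ≤ d) (a : ℝ) (ha : -(((d : ℝ) - 2) / 2) ^ 2 < a)
    (δ₀ : ℝ) (hδ₀ : 0 < δ₀) (hδ₀' : δ₀ < 1)
    (β : ℝ) (hβ : β = Real.sqrt (1 + 4 * min a 0 / ((d : ℝ) - 2) ^ 2))
    (W : EuclideanSpace ℝ (Fin d) → ℝ)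
    (hW : ∀ x, W x = ((d : ℝ) * ((d : ℝ) - 2) * β ^ 2) ^ (((d : ℝ) - 2) / 4) *
        (‖x‖ ^ (β - 1) / (1 + ‖x‖ ^ (2 * β))) ^ (((d : ℝ) - 2) / 2))
    (K : ℝ)
    (hK : K = ∫ x : EuclideanSpace ℝ (Fin d),
        ((∑ i, (fderiv ℝ W x (EuclideanSpace.single i 1)) ^ 2)
          + min a 0 / ‖x‖ ^ 2 * (W x) ^ 2))
    (EW : ℝ)
    (hEW : EW = (1 / 2) * K - (((d : ℝ) - 2) / (2 * (d : ℝ))) *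
        ∫ x : EuclideanSpace ℝ (Fin d), W x ^ (2 * (d : ℝ) / ((d : ℝ) - 2))) :
    ∃ δ₁ : ℝ, 0 < δ₁ ∧ ∃ c : ℝ, 0 < c ∧
      ∀ f : EuclideanSpace ℝ (Fin d) → ℂ,
        ContDiff ℝ (⊤ : ℕ∞) f → HasCompactSupport f →
        (0 : EuclideanSpace ℝ (Fin d)) ∉ tsupport f →
        ∀ Qf Ef : ℝ,
        Qf = (∫ x : EuclideanSpace ℝ (Fin d),
            ((∑ i, ‖fderiv ℝ f x (EuclideanSpace.single i 1)‖ ^ 2)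
              + a / ‖x‖ ^ 2 * ‖f x‖ ^ 2)) →
        Ef = (1 / 2) * Qf - (((d : ℝ) - 2) / (2 * (d : ℝ))) *
            (∫ x : EuclideanSpace ℝ (Fin d),
              ‖f x‖ ^ (2 * (d : ℝ) / ((d : ℝ) - 2))) →
        Ef ≤ (1 - δ₀) * EW → Qf ≥ K →
        (Qf ≥ (1 + δ₁) * K
          ∧ (∫ x : EuclideanSpace ℝ (Fin d),
              ((∑ i, ‖fderiv ℝ f x (EuclideanSpace.single i 1)‖ ^ 2)
                + a / ‖x‖ ^ 2 * ‖f x‖ ^ 2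
                - ‖f x‖ ^ (2 * (d : ℝ) / ((d : ℝ) - 2)))) ≤ -c
          ∧ (-c : ℝ) < 0) := by
  have hd3 : (3 : ℝ) ≤ d := by exact_mod_cast hd
  have hd2 : (0 : ℝ) < d - 2 := by linarith
  have hd0 : (0 : ℝ) < d := by linarith
  have hrad : 0 < 1 + 4 * min a 0 / ((d : ℝ) - 2) ^ 2 := by
    have h1 : -(((d : ℝ) - 2) / 2) ^ 2 < min a 0 := lt_min ha (by simp; positivity)
    have h2 : 1 + 4 * min a 0 / ((d : ℝ) - 2) ^ 2 =
        (((d : ℝ) - 2) ^ 2 + 4 * min a 0) / ((d : ℝ) - 2) ^ 2 := by field_simp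
    rw [h2]
    refine div_pos ?_ (by positivity)
    linarith
  have hβ0 : 0 < β := hβ ▸ Real.sqrt_pos.2 hrad
  have hβsq : β ^ 2 = 1 + 4 * min a 0 / ((d : ℝ) - 2) ^ 2 := by rw [hβ, Real.sq_sqrt hrad.le]
  have hβ1 : β ≤ 1 := by
    rw [hβ, Real.sqrt_le_one]
    have : 4 * min a 0 / ((d : ℝ) - 2) ^ 2 ≤ 0 :=
      div_nonpos_of_nonpos_of_nonneg (by linarith [min_le_right a 0]) (by positivity)
    linarith
  have hb : min a 0 = (β ^ 2 - 1) * (((d : ℝ) - 2) / 2) ^ 2 := by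
    rw [hβsq]
    field_simp
    ring
  obtain ⟨I, hI⟩ : ∃ I, I = ∫ x : EuclideanSpace ℝ (Fin d), ((1 + ‖x‖ ^ 2) ^ d)⁻¹ := ⟨_, rfl⟩
  have hI0 : 0 < I := hI ▸ integral_bubble_pos (by lia)
  obtain ⟨hWp, hWk⟩ := soliton_energies hd hβ0 hW hI
  rw [hb, hWk] at hK
  rw [hWp, ← hK] at hEW
  clear hWp hWk hW hβ hβsq
  set D : ℝ := (d : ℝ) * ((d : ℝ) - 2) * β ^ 2 with hD
  have hD0 : 0 < D := by positivity
  have hK0 : 0 < K := by rw [hK]; positivity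
  have hEW' : EW = K / d := by
    rw [hEW]
    field_simp
    ring
  have hη : 0 < 2 * δ₀ / ((d : ℝ) - 2) := by positivity
  have hδ₁ : 1 < (1 + 2 * δ₀ / ((d : ℝ) - 2)) ^ (((d : ℝ) - 2) / d) :=
    Real.one_lt_rpow (by linarith) (by positivity)
  refine ⟨(1 + 2 * δ₀ / ((d : ℝ) - 2)) ^ (((d : ℝ) - 2) / d) - 1, by linarith,
    2 * δ₀ / ((d : ℝ) - 2) * K, by positivity, ?_⟩
  intro f hf hs h0 Qf Ef hQf hEf hE hQK
  have hf1 : ContDiff ℝ 1 f := hf.of_le (by exact_mod_cast le_top)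
  have i0 := integrable_sum_norm_sq_fderiv hf1 hs
  have i1 : ∀ b : ℝ, Integrable fun x => b / ‖x‖ ^ 2 * ‖f x‖ ^ 2 := fun b =>
    integrable_of_continuousAt_of_notMem_tsupport hs h0 (fun x hx => by simp [hx]) fun x hx => by
      have := hf.continuous
      fun_prop (disch := simpa using hx)
  have hp0 : 0 < 2 * (d : ℝ) / (d - 2) := by positivity
  have i2 : Integrable fun x => ‖f x‖ ^ (2 * (d : ℝ) / (d - 2)) :=
    (hf.continuous.norm.rpow_const fun _ => Or.inr hp0.le).integrable_of_hasCompactSupport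
      (hs.comp_left (g := fun z : ℂ => ‖z‖ ^ (2 * (d : ℝ) / (d - 2))) (by
        simp [Real.zero_rpow hp0.ne']))
  have i3 : Integrable fun x => (∑ k, ‖fderiv ℝ f x (EuclideanSpace.single k 1)‖ ^ 2) +
      a / ‖x‖ ^ 2 * ‖f x‖ ^ 2 := i0.add (i1 a)
  rw [integral_sub i3 i2, ← hQf]
  have hS := sharp_hardy_sobolev hd (one_le_inv₀ hβ0 |>.2 hβ1) hf1 hs h0 hI (Q := Qf) (by
    rw [hQf]
    refine integral_mono (i0.add (i1 _)) i3 fun x => ?_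
    simp only [inv_inv, ← hb]
    gcongr
    exact min_le_left a 0)
  set S := ∫ x, ‖f x‖ ^ (2 * (d : ℝ) / (d - 2)) with hSdef
  have hS' : S ≤ K * (Qf / K) ^ ((d : ℝ) / (d - 2)) := by
    refine hS.trans (le_of_eq ?_)
    have h1 : β⁻¹ * Qf / (d * (d - 2) * I) = Qf / K * D ^ (((d : ℝ) - 2) / 2) := by
      have h2 : D ^ ((d : ℝ) / 2) = D ^ (((d : ℝ) - 2) / 2) * D := by
        rw [← Real.rpow_add_one hD0.ne']
        congr 1
        ring
      have h3 : 0 < D ^ (((d : ℝ) - 2) / 2) := by positivity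
      rw [hK, h2]
      generalize D ^ (((d : ℝ) - 2) / 2) = u at *
      rw [hD]
      field_simp
    rw [h1, Real.mul_rpow (div_nonneg (hK0.le.trans hQK) hK0.le) (by positivity),
      ← Real.rpow_mul hD0.le]
    have h2 : ((d : ℝ) - 2) / 2 * (d / (d - 2)) = d / 2 := by field_simp
    rw [h2]
    generalize (Qf / K) ^ ((d : ℝ) / (d - 2)) = u
    rw [hK]
    ring
  rw [hEf, hEW'] at hE
  have hE' : (d : ℝ) * Qf - (d - 2) * S ≤ 2 * (1 - δ₀) * K := by
    have h1 := mul_le_mul_of_nonneg_left hE (by positivity : 0 ≤ 2 * (d : ℝ))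
    have h2 : 2 * (d : ℝ) * (1 / 2 * Qf - (d - 2) / (2 * d) * S) = d * Qf - (d - 2) * S := by
      field_simp
    have h3 : 2 * (d : ℝ) * ((1 - δ₀) * (K / d)) = 2 * (1 - δ₀) * K := by field_simp
    linarith
  have hvir : Qf - S ≤ -(2 * δ₀ / ((d : ℝ) - 2) * K) := by
    have h1 : -(2 * δ₀ / ((d : ℝ) - 2) * K) = -(2 * δ₀ * K) / (d - 2) := by ring
    rw [h1, le_div_iff₀ hd2]
    nlinarith
  refine ⟨?_, hvir, by simp only [neg_lt_zero]; positivity⟩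
  have h1 : 1 + 2 * δ₀ / ((d : ℝ) - 2) ≤ (Qf / K) ^ ((d : ℝ) / (d - 2)) := by
    refine le_of_mul_le_mul_left ?_ hK0
    nlinarith
  have h2 := Real.rpow_le_rpow (by positivity) h1 (by positivity : 0 ≤ ((d : ℝ) - 2) / d)
  have h3 : (d : ℝ) / (d - 2) * ((d - 2) / d) = 1 := by field_simp
  rw [← Real.rpow_mul (div_nonneg (hK0.le.trans hQK) hK0.le), h3, Real.rpow_one,
    le_div_iff₀ hK0] at h2
  rw [add_sub_cancel]
  exact h2
end

section
/- Fix R > 0 and define the vector field b : ℝ³ → ℝ³ by b(x) := x / (R·√(1 + |x|²/R²)). Then for every x ∈ ℝ³ the Jacobian matrix (∂_k b_j)(x) is symmetric with entries ∂_k b_j(x) = δ_{jk}/(R⟨x/R⟩) - x_j x_k/(R³⟨x/R⟩³), where ⟨y⟩ := √(1+|y|²), and it satisfies the matrix lower bound: for every v ∈ ℝ³, Σ_{j,k=1}^{3} v_j (∂_k b_j)(x) v_k ≥ |v|² / (R⟨x/R⟩³). -/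
section JapaneseBracket

variable {E : Type*} [NormedAddCommGroup E] [InnerProductSpace ℝ E]

open scoped RealInnerProductSpace

theorem fderiv_inv_mul_sqrt_smul_apply {R : ℝ} (hR : 0 < R) (x w : E) :
    fderiv ℝ (fun y : E => (R * Real.sqrt (1 + ‖y‖ ^ 2 / R ^ 2))⁻¹ • y) x w
      = (R * Real.sqrt (1 + ‖x‖ ^ 2 / R ^ 2))⁻¹ • w
        - (⟪x, w⟫ / (R ^ 3 * Real.sqrt (1 + ‖x‖ ^ 2 / R ^ 2) ^ 3)) • x := by
  have hpos : 0 < 1 + ‖x‖ ^ 2 / R ^ 2 := by positivity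
  have hs : 0 < Real.sqrt (1 + ‖x‖ ^ 2 / R ^ 2) := Real.sqrt_pos.2 hpos
  have hnorm : HasFDerivAt (fun y : E => ‖y‖ ^ 2) (2 • innerSL ℝ x) x :=
    (hasStrictFDerivAt_norm_sq x).hasFDerivAt
  have hsq : HasDerivAt (fun t : ℝ => 1 + t / R ^ 2) (1 / R ^ 2) (‖x‖ ^ 2) :=
    ((hasDerivAt_id _).div_const _).const_add 1
  have hscalar := ((hsq.sqrt hpos.ne').const_mul R).fun_inv (mul_pos hR hs).ne'
  have hb := (hscalar.comp_hasFDerivAt x hnorm).smul (hasFDerivAt_id x)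
  have key := congrArg (fun L : E →L[ℝ] E => L w) hb.fderiv
  refine Eq.trans key ?_
  simp only [Function.comp_apply, id_eq, add_apply,
    smul_apply, ContinuousLinearMap.smulRight_apply,
    ContinuousLinearMap.id_apply, innerSL_apply_apply, sub_eq_add_neg, ← neg_smul]
  congr 2
  simp only [nsmul_eq_mul, smul_eq_mul]
  field_simp
  norm_num

theorem norm_sq_div_le_norm_sq_div_sub_inner_sq_div {R : ℝ} (hR : 0 < R) (x v : E) :
    ‖v‖ ^ 2 / (R * Real.sqrt (1 + ‖x‖ ^ 2 / R ^ 2) ^ 3)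
      ≤ ‖v‖ ^ 2 / (R * Real.sqrt (1 + ‖x‖ ^ 2 / R ^ 2))
        - ⟪x, v⟫ ^ 2 / (R ^ 3 * Real.sqrt (1 + ‖x‖ ^ 2 / R ^ 2) ^ 3) := by
  have hpos : 0 < 1 + ‖x‖ ^ 2 / R ^ 2 := by positivity
  have hsq : R ^ 2 * Real.sqrt (1 + ‖x‖ ^ 2 / R ^ 2) ^ 2 = R ^ 2 + ‖x‖ ^ 2 := by
    rw [Real.sq_sqrt hpos.le]
    field_simp
  have hs : 0 < Real.sqrt (1 + ‖x‖ ^ 2 / R ^ 2) := Real.sqrt_pos.2 hpos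
  generalize Real.sqrt (1 + ‖x‖ ^ 2 / R ^ 2) = s at hs hsq ⊢
  have hcs : ⟪x, v⟫ ^ 2 ≤ ‖x‖ ^ 2 * ‖v‖ ^ 2 := by
    rw [← mul_pow, ← sq_abs]
    exact pow_le_pow_left₀ (abs_nonneg _) (abs_real_inner_le_norm x v) 2
  have hdiff : ‖v‖ ^ 2 / (R * s) - ⟪x, v⟫ ^ 2 / (R ^ 3 * s ^ 3) - ‖v‖ ^ 2 / (R * s ^ 3)
      = (‖x‖ ^ 2 * ‖v‖ ^ 2 - ⟪x, v⟫ ^ 2) / (R ^ 3 * s ^ 3) := by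
    rw [eq_sub_of_add_eq' hsq.symm]
    field_simp
    ring
  have : 0 ≤ (‖x‖ ^ 2 * ‖v‖ ^ 2 - ⟪x, v⟫ ^ 2) / (R ^ 3 * s ^ 3) :=
    div_nonneg (sub_nonneg.2 hcs) (by positivity)
  linarith

end JapaneseBracket

/-- For `b(x) = x/(R⟨x/R⟩)` with `⟨y⟩ = √(1+|y|²)`, the Jacobian
matrix `∂_k b_j(x) = δ_{jk}/(R⟨x/R⟩) - x_j x_k/(R³⟨x/R⟩³)` is symmetric and
satisfies the matrix lower bound `v·(∂b)v ≥ |v|²/(R⟨x/R⟩³)`. -/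
theorem morawetz_weight_jacobian
    (R : ℝ) (hR : 0 < R)
    (b : EuclideanSpace ℝ (Fin 3) → EuclideanSpace ℝ (Fin 3))
    (hb : ∀ x : EuclideanSpace ℝ (Fin 3),
      b x = (R * Real.sqrt (1 + ‖x‖ ^ 2 / R ^ 2))⁻¹ • x)
    (x : EuclideanSpace ℝ (Fin 3)) :
    (∀ j k : Fin 3,
        fderiv ℝ b x (EuclideanSpace.single k 1) j
          = (if j = k then (1 : ℝ) else 0) / (R * Real.sqrt (1 + ‖x‖ ^ 2 / R ^ 2))
            - x j * x k / (R ^ 3 * Real.sqrt (1 + ‖x‖ ^ 2 / R ^ 2) ^ 3))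
    ∧ (∀ j k : Fin 3,
        fderiv ℝ b x (EuclideanSpace.single k 1) j
          = fderiv ℝ b x (EuclideanSpace.single j 1) k)
    ∧ (∀ v : EuclideanSpace ℝ (Fin 3),
        ‖v‖ ^ 2 / (R * Real.sqrt (1 + ‖x‖ ^ 2 / R ^ 2) ^ 3)
          ≤ ∑ j, ∑ k, v j * fderiv ℝ b x (EuclideanSpace.single k 1) j * v k) := by
  obtain rfl : b = fun y => (R * Real.sqrt (1 + ‖y‖ ^ 2 / R ^ 2))⁻¹ • y := funext hb
  have entry : ∀ j k : Fin 3,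
      fderiv ℝ (fun y : EuclideanSpace ℝ (Fin 3) =>
          (R * Real.sqrt (1 + ‖y‖ ^ 2 / R ^ 2))⁻¹ • y) x (EuclideanSpace.single k 1) j
        = (if j = k then (1 : ℝ) else 0) / (R * Real.sqrt (1 + ‖x‖ ^ 2 / R ^ 2))
          - x j * x k / (R ^ 3 * Real.sqrt (1 + ‖x‖ ^ 2 / R ^ 2) ^ 3) := by
    intro j k
    rw [fderiv_inv_mul_sqrt_smul_apply hR, EuclideanSpace.inner_single_right]
    simp only [PiLp.sub_apply, PiLp.smul_apply, PiLp.single_apply, smul_eq_mul,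
      conj_trivial, one_mul]
    ring
  refine ⟨entry, fun j k => ?_, fun v => ?_⟩
  · simp only [entry, eq_comm (a := j), mul_comm (x j)]
  · refine (norm_sq_div_le_norm_sq_div_sub_inner_sq_div hR x v).trans_eq ?_
    simp only [entry]
    generalize Real.sqrt (1 + ‖x‖ ^ 2 / R ^ 2) = s
    simp only [EuclideanSpace.real_norm_sq_eq, PiLp.inner_apply, RCLike.inner_apply,
      conj_trivial, Fin.sum_univ_three]
    simp
    ring
end

section
/- Fix R > 0 and define the vector field b : ℝ³ → ℝ³ by b(x) := x / (R·√(1 + |x|²/R²)), with divergence div b(x) = Σ_j ∂_j b_j(x). Then for every x ∈ ℝ³ one has the identity -Δ(div b)(x) = 15 / (R³ ⟨x/R⟩⁷), where ⟨y⟩ := √(1+|y|²); in particular -Δ(div b) is everywhere strictly positive. -/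
/-- The gradient of `⟨x/R⟩⁻ⁿ` is `-n ⟨x/R⟩⁻⁽ⁿ⁺²⁾ x / R²`. -/
theorem hasFDerivAt_inv_sqrt_one_add_norm_sq_div_pow
    {E : Type*} [NormedAddCommGroup E] [InnerProductSpace ℝ E] (R : ℝ) (n : ℕ) (x : E) :
    HasFDerivAt (fun y : E => (Real.sqrt (1 + ‖y‖ ^ 2 / R ^ 2))⁻¹ ^ n)
      ((-(n * (Real.sqrt (1 + ‖x‖ ^ 2 / R ^ 2))⁻¹ ^ (n + 2) / R ^ 2)) • innerSL ℝ x) x := by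
  have hpos : 0 < 1 + ‖x‖ ^ 2 / R ^ 2 := by positivity
  have hsqrt : Real.sqrt (1 + ‖x‖ ^ 2 / R ^ 2) ≠ 0 := (Real.sqrt_pos.2 hpos).ne'
  have hsq : HasFDerivAt (fun y : E => 1 + ‖y‖ ^ 2 / R ^ 2) ((R ^ 2)⁻¹ • 2 • innerSL ℝ x) x := by
    simpa only [div_eq_mul_inv] using
      ((hasStrictFDerivAt_norm_sq x).hasFDerivAt.mul_const (R ^ 2)⁻¹).const_add 1
  have hscalar := (((Real.hasDerivAt_sqrt hpos.ne').inv hsqrt).pow n).comp_hasFDerivAt x hsq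
  refine hscalar.congr_fderiv ?_
  ext v
  rcases n with _ | n
  · simp
  · simp only [smul_apply, smul_eq_mul, nsmul_eq_mul, Nat.add_sub_cancel,
      Pi.inv_apply, inv_pow]
    push_cast
    field_simp
    ring

/-- The divergence of `x / (R⟨x/R⟩)` on `ℝ³` is `(2⟨x/R⟩⁻¹ + ⟨x/R⟩⁻³) / R`. -/
theorem sum_fderiv_inv_sqrt_smul_self_apply_single
    {R : ℝ} (hR : R ≠ 0) (x : EuclideanSpace ℝ (Fin 3)) :
    ∑ j, fderiv ℝ (fun y : EuclideanSpace ℝ (Fin 3) =>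
        (R * Real.sqrt (1 + ‖y‖ ^ 2 / R ^ 2))⁻¹ • y) x (EuclideanSpace.single j 1) j
      = R⁻¹ * (2 * (Real.sqrt (1 + ‖x‖ ^ 2 / R ^ 2))⁻¹ ^ 1
          + (Real.sqrt (1 + ‖x‖ ^ 2 / R ^ 2))⁻¹ ^ 3) := by
  have hpos : 0 < 1 + ‖x‖ ^ 2 / R ^ 2 := by positivity
  have hsq := Real.sq_sqrt hpos.le
  have hderiv := ((hasFDerivAt_inv_sqrt_one_add_norm_sq_div_pow R 1 x).const_mul R⁻¹).fun_smul
    (hasFDerivAt_id x)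
  have hfun : (fun y : EuclideanSpace ℝ (Fin 3) =>
      (R * Real.sqrt (1 + ‖y‖ ^ 2 / R ^ 2))⁻¹ • y)
      = fun y => (R⁻¹ * (Real.sqrt (1 + ‖y‖ ^ 2 / R ^ 2))⁻¹ ^ 1) • id y := by
    funext y
    rw [mul_inv, pow_one, id]
  rw [hfun, HasFDerivAt.fderiv hderiv]
  have hnorm := EuclideanSpace.real_norm_sq_eq x
  set J := Real.sqrt (1 + ‖x‖ ^ 2 / R ^ 2)
  have hJ : J ≠ 0 := (Real.sqrt_pos.2 hpos).ne'
  rw [hnorm] at hsq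
  simp [Fin.sum_univ_three, EuclideanSpace.inner_single_right] at hsq ⊢
  field_simp at hsq ⊢
  linear_combination hsq

/-- For `b(x) = x/(R⟨x/R⟩)` with `⟨y⟩ = √(1+|y|²)` on `ℝ³`, the
bi-Laplacian term in the weighted momentum identity satisfies
`-Δ(div b)(x) = 15/(R³⟨x/R⟩⁷) > 0`. -/
theorem morawetz_weight_bilaplacian
    (R : ℝ) (hR : 0 < R)
    (b : EuclideanSpace ℝ (Fin 3) → EuclideanSpace ℝ (Fin 3))
    (hb : ∀ x : EuclideanSpace ℝ (Fin 3),
      b x = (R * Real.sqrt (1 + ‖x‖ ^ 2 / R ^ 2))⁻¹ • x)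
    (divb : EuclideanSpace ℝ (Fin 3) → ℝ)
    (hdiv : ∀ x : EuclideanSpace ℝ (Fin 3),
      divb x = ∑ j, fderiv ℝ b x (EuclideanSpace.single j 1) j)
    (x : EuclideanSpace ℝ (Fin 3)) :
    (-(∑ i, fderiv ℝ (fun y => fderiv ℝ divb y (EuclideanSpace.single i 1)) x
          (EuclideanSpace.single i 1))
        = 15 / (R ^ 3 * Real.sqrt (1 + ‖x‖ ^ 2 / R ^ 2) ^ 7))
    ∧ 0 < 15 / (R ^ 3 * Real.sqrt (1 + ‖x‖ ^ 2 / R ^ 2) ^ 7) := by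
  have hpos : ∀ y : EuclideanSpace ℝ (Fin 3), 0 < 1 + ‖y‖ ^ 2 / R ^ 2 := fun y => by positivity
  have hJpos : 0 < Real.sqrt (1 + ‖x‖ ^ 2 / R ^ 2) := Real.sqrt_pos.2 (hpos x)
  refine ⟨?_, by positivity⟩
  obtain rfl : b = _ := funext hb
  obtain rfl : divb = _ := funext fun y =>
    (hdiv y).trans (sum_fderiv_inv_sqrt_smul_self_apply_single hR.ne' y)
  have hgrad : ∀ i : Fin 3, (fun y : EuclideanSpace ℝ (Fin 3) =>
      fderiv ℝ (fun x : EuclideanSpace ℝ (Fin 3) =>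
        R⁻¹ * (2 * (Real.sqrt (1 + ‖x‖ ^ 2 / R ^ 2))⁻¹ ^ 1
          + (Real.sqrt (1 + ‖x‖ ^ 2 / R ^ 2))⁻¹ ^ 3)) y (EuclideanSpace.single i 1))
      = fun y => (-(R⁻¹ ^ 3) * (2 * (Real.sqrt (1 + ‖y‖ ^ 2 / R ^ 2))⁻¹ ^ 3
          + 3 * (Real.sqrt (1 + ‖y‖ ^ 2 / R ^ 2))⁻¹ ^ 5))
          * EuclideanSpace.proj (𝕜 := ℝ) i y := by
    intro i
    funext y
    rw [HasFDerivAt.fderiv ((((hasFDerivAt_inv_sqrt_one_add_norm_sq_div_pow R 1 y).const_mul 2).fun_add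
      (hasFDerivAt_inv_sqrt_one_add_norm_sq_div_pow R 3 y)).const_mul R⁻¹)]
    simp [EuclideanSpace.inner_single_right]
    field_simp
    ring
  have hhess : ∀ i : Fin 3, HasFDerivAt _ _ x := fun i =>
    ((((hasFDerivAt_inv_sqrt_one_add_norm_sq_div_pow R 3 x).const_mul 2).fun_add
      ((hasFDerivAt_inv_sqrt_one_add_norm_sq_div_pow R 5 x).const_mul 3)).const_mul
        (-(R⁻¹ ^ 3))).fun_mul (EuclideanSpace.proj (𝕜 := ℝ) i).hasFDerivAt
  simp only [hgrad]
  rw [Finset.sum_congr rfl fun i _ =>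
    congrArg (fun L => L (EuclideanSpace.single i 1)) (HasFDerivAt.fderiv (hhess i))]
  have hsq := Real.sq_sqrt (hpos x).le
  have hnorm := EuclideanSpace.real_norm_sq_eq x
  set J := Real.sqrt (1 + ‖x‖ ^ 2 / R ^ 2)
  rw [hnorm] at hsq
  simp [Fin.sum_univ_three, EuclideanSpace.inner_single_right] at hsq ⊢
  field_simp at hsq ⊢
  linear_combination (6 * J ^ 2 + 15) * hsq
end
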